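/- arXiv:2409.15455 — 5 statements merged into one kernel-verified Lean document; each statement's English description precedes it below -/
import Mathlib

section
/- Every claw-free cubic graph admits a (1,1,2,2)-packing coloring. -/
open SimpleGraph

/-- A graph is claw-free if it has no induced subgraph isomorphic to `K_{1,3}`. -/
def IsClawFree {V : Type*} (G : SimpleGraph V) : Prop :=
  ¬ ∃ v a b c : V, a ≠ b ∧ a ≠ c ∧ b ≠ c ∧
    G.Adj v a ∧ G.Adj v b ∧ G.Adj v c ∧ ¬ G.Adj a b ∧ ¬ G.Adj a c ∧ ¬ G.Adj b c

/-- A `(1,1,2,2)`-packing coloring of `G`: a partition of the vertex set (given by a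
function to `Fin 4`) into two independent sets (colors `0`, `1`) and two `2`-packings
(colors `2`, `3`), i.e. sets of vertices pairwise at distance greater than `2`. -/
def IsColoring1122 {V : Type*} (G : SimpleGraph V) (f : V → Fin 4) : Prop :=
  (∀ u v : V, f u = 0 → f v = 0 → ¬ G.Adj u v) ∧
  (∀ u v : V, f u = 1 → f v = 1 → ¬ G.Adj u v) ∧
  (∀ u v : V, u ≠ v → f u = 2 → f v = 2 → 2 < G.edist u v) ∧
  (∀ u v : V, u ≠ v → f u = 3 → f v = 3 → 2 < G.edist u v)

/-- `T G u v`: the edge `uv` lies in a triangle. -/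
def TAdj {V : Type*} (G : SimpleGraph V) (u v : V) : Prop :=
  G.Adj u v ∧ ∃ w, G.Adj u w ∧ G.Adj v w

/-- A diamond with ends `a`, `b`, middle vertices `m`, `n`, and outer neighbours `a'`, `b'`. -/
structure Dia {V : Type*} (G : SimpleGraph V) (a m n b a' b' : V) : Prop where
  am : a ≠ m
  an : a ≠ n
  ab : a ≠ b
  mn : m ≠ n
  mb : m ≠ b
  nb : n ≠ b
  Na : ∀ u, G.Adj a u ↔ u = m ∨ u = n ∨ u = a'
  Nm : ∀ u, G.Adj m u ↔ u = a ∨ u = n ∨ u = b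
  Nn : ∀ u, G.Adj n u ↔ u = a ∨ u = m ∨ u = b
  Nb : ∀ u, G.Adj b u ↔ u = m ∨ u = n ∨ u = b'
  Ta : ∀ u, TAdj G a u ↔ u = m ∨ u = n
  Tm : ∀ u, TAdj G m u ↔ u = a ∨ u = n ∨ u = b
  Tn : ∀ u, TAdj G n u ↔ u = a ∨ u = m ∨ u = b
  Tb : ∀ u, TAdj G b u ↔ u = m ∨ u = n
  oa : a' ≠ a ∧ a' ≠ m ∧ a' ≠ n ∧ a' ≠ b
  ob : b' ≠ a ∧ b' ≠ m ∧ b' ≠ n ∧ b' ≠ b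

/-- A triangle `w p q` none of whose edges lies in another triangle. -/
structure Tri {V : Type*} (G : SimpleGraph V) (w p q w' p' q' : V) : Prop where
  wp : w ≠ p
  wq : w ≠ q
  pq : p ≠ q
  Nw : ∀ u, G.Adj w u ↔ u = p ∨ u = q ∨ u = w'
  Np : ∀ u, G.Adj p u ↔ u = w ∨ u = q ∨ u = p'
  Nq : ∀ u, G.Adj q u ↔ u = w ∨ u = p ∨ u = q'
  Tw : ∀ u, TAdj G w u ↔ u = p ∨ u = q
  Tp : ∀ u, TAdj G p u ↔ u = w ∨ u = q
  Tq : ∀ u, TAdj G q u ↔ u = w ∨ u = p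
  ow : w' ≠ w ∧ w' ≠ p ∧ w' ≠ q
  op : p' ≠ w ∧ p' ≠ p ∧ p' ≠ q
  oq : q' ≠ w ∧ q' ≠ p ∧ q' ≠ q

/-- A component `K_4`. -/
structure Kfour {V : Type*} (G : SimpleGraph V) (a b c d : V) : Prop where
  ab : a ≠ b
  ac : a ≠ c
  ad : a ≠ d
  bc : b ≠ c
  bd : b ≠ d
  cd : c ≠ d
  Na : ∀ u, G.Adj a u ↔ u = b ∨ u = c ∨ u = d
  Nb : ∀ u, G.Adj b u ↔ u = a ∨ u = c ∨ u = d
  Nc : ∀ u, G.Adj c u ↔ u = a ∨ u = b ∨ u = d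
  Nd : ∀ u, G.Adj d u ↔ u = a ∨ u = b ∨ u = c

lemma TAdj.symm {V : Type*} {G : SimpleGraph V} {u v : V} (h : TAdj G u v) : TAdj G v u := by
  obtain ⟨h, w, h1, h2⟩ := h
  exact ⟨h.symm, w, h2, h1⟩

lemma Dia.flip {V : Type*} {G : SimpleGraph V} {a m n b a' b' : V} (h : Dia G a m n b a' b') :
    Dia G b m n a b' a' := by
  obtain ⟨h1, h2, h3, h4, h5, h6, h7, h8, h9, h10, h11, h12, h13, h14, h15, h16⟩ := h
  constructor <;> grind

lemma nbrs_of_cubic {V : Type*} [Fintype V] [DecidableEq V]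
    (G : SimpleGraph V) [DecidableRel G.Adj] (hcubic : ∀ v : V, G.degree v = 3) (v : V) :
    ∃ x y z, x ≠ y ∧ x ≠ z ∧ y ≠ z ∧ ∀ u, G.Adj v u ↔ u = x ∨ u = y ∨ u = z := by
  have h := hcubic v
  rw [← G.card_neighborFinset_eq_degree, Finset.card_eq_three] at h
  obtain ⟨x, y, z, h1, h2, h3, h4⟩ := h
  refine ⟨x, y, z, h1, h2, h3, fun u => ?_⟩
  rw [← G.mem_neighborFinset, h4]
  simp

/-- third neighbour -/
lemma third {V : Type*} [Fintype V] [DecidableEq V]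
    (G : SimpleGraph V) [DecidableRel G.Adj] (hcubic : ∀ v : V, G.degree v = 3) {v x y : V}
    (hx : G.Adj v x) (hy : G.Adj v y) (hxy : x ≠ y) :
    ∃ z, x ≠ z ∧ y ≠ z ∧ v ≠ z ∧ ∀ u, G.Adj v u ↔ u = x ∨ u = y ∨ u = z := by
  obtain ⟨a, b, c, h1, h2, h3, h⟩ := nbrs_of_cubic G hcubic v
  have hv : ¬ G.Adj v v := G.loopless.irrefl v
  have ha := (h x).1 hx
  have hb := (h y).1 hy
  have : ∃ z, x ≠ z ∧ y ≠ z ∧ ∀ u, G.Adj v u ↔ u = x ∨ u = y ∨ u = z := by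
    rcases ha with rfl | rfl | rfl <;> rcases hb with rfl | rfl | rfl
    · exact absurd rfl hxy
    · exact ⟨c, by grind⟩
    · exact ⟨b, by grind⟩
    · exact ⟨c, by grind⟩
    · exact absurd rfl hxy
    · exact ⟨a, by grind⟩
    · exact ⟨b, by grind⟩
    · exact ⟨a, by grind⟩
    · exact absurd rfl hxy
  obtain ⟨z, h1, h2, h3⟩ := this
  exact ⟨z, h1, h2, by grind, h3⟩

lemma mkDia {V : Type*} [Fintype V] [DecidableEq V]
    (G : SimpleGraph V) [DecidableRel G.Adj] (hcubic : ∀ v : V, G.degree v = 3)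
    {a m n b : V} (am : G.Adj a m) (an : G.Adj a n) (mn : G.Adj m n) (bm : G.Adj b m)
    (bn : G.Adj b n) (hab : ¬ G.Adj a b) (hne : a ≠ b) : ∃ a' b', Dia G a m n b a' b' := by
  obtain ⟨a', a1, a2, a3, Na⟩ := third G hcubic am an mn.ne
  obtain ⟨b', b1, b2, b3, Nb⟩ := third G hcubic bm bn mn.ne
  obtain ⟨x, x1, x2, x3, Nm⟩ := third G hcubic am.symm mn an.ne
  obtain ⟨y, y1, y2, y3, Nn⟩ := third G hcubic an.symm mn.symm am.ne
  have hx : x = b := by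
    have := (Nm b).1 bm.symm
    have := bn.ne
    grind
  have hy : y = b := by
    have := (Nn b).1 bn.symm
    have := bm.ne
    grind
  subst hx
  subst hy
  have hsy : ∀ u v, G.Adj u v → G.Adj v u := fun u v h => h.symm
  have hir : ∀ u v, G.Adj u v → u ≠ v := fun u v h => h.ne
  refine ⟨a', b', ?_⟩
  constructor <;> (try unfold TAdj) <;> grind

lemma mkTri {V : Type*} [Fintype V] [DecidableEq V]
    (G : SimpleGraph V) [DecidableRel G.Adj] (hcubic : ∀ v : V, G.degree v = 3)
    {w p q : V} (wp : G.Adj w p) (wq : G.Adj w q) (pq : G.Adj p q)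
    (h1 : ∀ x, G.Adj w x → G.Adj p x → x = q) (h2 : ∀ x, G.Adj w x → G.Adj q x → x = p)
    (h3 : ∀ x, G.Adj p x → G.Adj q x → x = w) : ∃ w' p' q', Tri G w p q w' p' q' := by
  obtain ⟨w', a1, a2, a3, Nw⟩ := third G hcubic wp wq pq.ne
  obtain ⟨p', b1, b2, b3, Np⟩ := third G hcubic wp.symm pq wq.ne
  obtain ⟨q', c1, c2, c3, Nq⟩ := third G hcubic wq.symm pq.symm wp.ne
  have hsy : ∀ u v, G.Adj u v → G.Adj v u := fun u v h => h.symm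
  have hir : ∀ u v, G.Adj u v → u ≠ v := fun u v h => h.ne
  refine ⟨w', p', q', ?_⟩
  constructor <;> (try unfold TAdj) <;> grind

lemma unit_cases {V : Type*} [Fintype V] [DecidableEq V]
    (G : SimpleGraph V) [DecidableRel G.Adj]
    (hcubic : ∀ v : V, G.degree v = 3) (hclawfree : IsClawFree G) (v : V) :
    (∃ b c d, Kfour G v b c d) ∨
    (∃ a m n b a' b', Dia G a m n b a' b' ∧ (v = a ∨ v = m)) ∨
    (∃ p q v' p' q', Tri G v p q v' p' q') := by
  obtain ⟨x, y, z, vx, vy, vz, xy, hxz, hyz⟩ : ∃ x y z, G.Adj v x ∧ G.Adj v y ∧ G.Adj v z ∧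
      G.Adj x y ∧ x ≠ z ∧ y ≠ z := by
    obtain ⟨x, y, z, h1, h2, h3, h⟩ := nbrs_of_cubic G hcubic v
    by_contra hcon
    apply hclawfree
    have hx := (h x).2 (by simp)
    have hy := (h y).2 (by simp)
    have hz := (h z).2 (by simp)
    refine ⟨v, x, y, z, h1, h2, h3, hx, hy, hz, ?_, ?_, ?_⟩
    · intro h; exact hcon ⟨x, y, z, hx, hy, hz, h, h2, h3⟩
    · intro h; exact hcon ⟨x, z, y, hx, hz, hy, h, h1, h3.symm⟩
    · intro h; exact hcon ⟨y, z, x, hy, hz, hx, h, h1.symm, h2.symm⟩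
  have hsy : ∀ u v, G.Adj u v → G.Adj v u := fun u v h => h.symm
  have hir : ∀ u v, G.Adj u v → u ≠ v := fun u v h => h.ne
  have Nv : ∀ u, G.Adj v u ↔ u = x ∨ u = y ∨ u = z := by
    obtain ⟨t, _, _, _, h⟩ := third G hcubic vx vy xy.ne
    grind
  by_cases zx : G.Adj z x <;> by_cases zy : G.Adj z y
  · left
    obtain ⟨t1, _, _, _, Nx⟩ := third G hcubic vx.symm xy vy.ne
    obtain ⟨t2, _, _, _, Ny⟩ := third G hcubic vy.symm xy.symm vx.ne
    obtain ⟨t3, _, _, _, Nz⟩ := third G hcubic zx zy xy.ne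
    exact ⟨x, y, z, by constructor <;> grind⟩
  · right; left
    obtain ⟨a', b', h⟩ := mkDia G hcubic vy.symm xy.symm vx vz.symm zx (by grind) hyz
    exact ⟨_, _, _, _, _, _, h, Or.inr rfl⟩
  · right; left
    obtain ⟨a', b', h⟩ := mkDia G hcubic vx.symm xy vy vz.symm zy (by grind) hxz
    exact ⟨_, _, _, _, _, _, h, Or.inr rfl⟩
  · right
    by_cases hc : ∃ t, G.Adj x t ∧ G.Adj y t ∧ t ≠ v
    · left
      obtain ⟨t, h1, h2, h3⟩ := hc
      obtain ⟨a', b', h⟩ := mkDia G hcubic vx vy xy h1.symm h2.symm (by grind) h3.symm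
      exact ⟨_, _, _, _, _, _, h, Or.inl rfl⟩
    · right
      obtain ⟨a, b, c, h⟩ := mkTri G hcubic vx vy xy (by grind) (by grind) (by grind)
      exact ⟨_, _, _, _, _, h⟩

lemma outer_unique {V : Type*} [Fintype V] [DecidableEq V]
    (G : SimpleGraph V) [DecidableRel G.Adj]
    (hcubic : ∀ v : V, G.degree v = 3) (hclawfree : IsClawFree G) {v x y : V}
    (hx : G.Adj v x) (hy : G.Adj v y) (tx : ¬ TAdj G v x) (ty : ¬ TAdj G v y) : x = y := by
  rcases unit_cases G hcubic hclawfree v with ⟨b, c, d, h⟩ | ⟨a, m, n, b, a', b', h, rfl | rfl⟩ |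
    ⟨p, q, v', p', q', h⟩
  · exfalso
    obtain ⟨h1, h2, h3, h4, h5, h6, h7, h8, h9, h10⟩ := h
    apply tx
    refine ⟨hx, ?_⟩
    rcases (h7 x).1 hx with rfl | rfl | rfl
    · exact ⟨c, by grind⟩
    · exact ⟨b, by grind⟩
    · exact ⟨b, by grind⟩
  · have := h.Na; have := h.Ta; grind
  · have := h.Nm; have := h.Tm; grind
  · have := h.Nw; have := h.Tw; grind

/-- fixed-point-free involutions have a two-colouring -/
lemma invol_color {Q : Type*} (s : Q → Q) (h : ∀ q, s (s q) = q) (h' : ∀ q, s q ≠ q) :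
    ∃ f : Q → Bool, ∀ q, f (s q) ≠ f q := by
  classical
  refine ⟨fun q => decide (WellOrderingRel q (s q)), fun q => ?_⟩
  simp only [h, ne_eq, decide_eq_decide]
  intro hh
  rcases trichotomous_of WellOrderingRel q (s q) with h1 | h1 | h1
  · exact asymm_of WellOrderingRel h1 (hh.2 h1)
  · exact h' q h1.symm
  · exact asymm_of WellOrderingRel h1 (hh.1 h1)

lemma two_invol {W : Type*} (s t : Equiv.Perm W) (hs : ∀ q, s (s q) = q) (ht : ∀ q, t (t q) = q)
    (hs' : ∀ q, s q ≠ q) (ht' : ∀ q, t q ≠ q) :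
    ∃ f : W → Bool, ∀ q, f (s q) ≠ f q ∧ f (t q) ≠ f q := by
  have hss : s * s = 1 := by ext q; simp [hs]
  have htt : t * t = 1 := by ext q; simp [ht]
  have hsi : s⁻¹ = s := inv_eq_of_mul_eq_one_left hss
  have hti : t⁻¹ = t := inv_eq_of_mul_eq_one_left htt
  set r := s * t with hr
  have hconj : s * r * s⁻¹ = r⁻¹ := by
    rw [hr, mul_inv_rev, hsi, hti, ← mul_assoc, hss, one_mul]
  have hconjk : ∀ k : ℤ, s * r ^ k = r ^ (-k) * s := by
    intro k
    have : s * r ^ k * s⁻¹ = r ^ (-k) := by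
      rw [← conj_zpow, hconj, inv_zpow, zpow_neg]
    rw [← this]; simp
  have hsr : s * r = t := by rw [hr, ← mul_assoc, hss, one_mul]
  have key : ∀ x (k : ℤ), (r ^ k) x ≠ s x := by
    intro x k hk
    rcases Int.even_or_odd' k with ⟨j, rfl | rfl⟩
    · apply hs' ((r ^ j) x)
      have : (s * r ^ j) x = (r ^ (-j) * s) x := by rw [hconjk]
      simp only [Equiv.Perm.mul_apply] at this
      rw [this, ← hk, ← Equiv.Perm.mul_apply, ← zpow_add]
      congr 2; ring
    · apply ht' ((r ^ j) x)
      have : (s * r ^ (j+1)) x = (r ^ (-(j+1)) * s) x := by rw [hconjk]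
      rw [add_comm, zpow_add, ← mul_assoc, zpow_one, hsr] at this
      simp only [Equiv.Perm.mul_apply] at this
      rw [this, ← hk, ← Equiv.Perm.mul_apply, ← zpow_add]
      congr 2; ring
  let S : Setoid W := Equiv.Perm.SameCycle.setoid r
  have hS : ∀ x y, S x y ↔ ∃ k : ℤ, (r ^ k) x = y := fun x y => Iff.rfl
  have hmap : ∀ x y, S x y → S (s x) (s y) := by
    rintro x y ⟨k, rfl⟩
    refine ⟨-k, ?_⟩
    rw [← Equiv.Perm.mul_apply, ← hconjk]; rfl
  let σ : Quotient S → Quotient S := Quotient.map s hmap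
  obtain ⟨f, hf⟩ := invol_color σ
    (by rintro ⟨x⟩; exact congrArg (Quotient.mk S) (hs x))
    (by
      rintro ⟨x⟩ hx
      obtain ⟨k, hk⟩ := Quotient.exact hx.symm
      exact key x k hk)
  refine ⟨fun x => f (Quotient.mk S x), fun q => ⟨hf (Quotient.mk S q), ?_⟩⟩
  have : Quotient.mk S (t q) = Quotient.mk S (s q) := by
    apply Quotient.sound
    refine ⟨1, ?_⟩
    rw [zpow_one, hr, Equiv.Perm.mul_apply, ht]
  change f (Quotient.mk S (t q)) ≠ f (Quotient.mk S q)
  rw [this]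
  exact hf (Quotient.mk S q)

/-- extend a partial matching to a fixed-point-free involution on two copies -/
lemma match_perm {V : Type*} (M : V → V → Prop) (hsy : ∀ x y, M x y → M y x)
    (hir : ∀ x, ¬ M x x) (hu : ∀ x y z, M x y → M x z → y = z) :
    ∃ s : Equiv.Perm (V × Bool), (∀ q, s (s q) = q) ∧ (∀ q, s q ≠ q) ∧
      ∀ x y, M x y → s (x, true) = (y, true) := by
  classical
  let F : V × Bool → V × Bool := fun q =>
    if h : ∃ y, M q.1 y then (h.choose, q.2) else (q.1, !q.2)
  have hF1 : ∀ x y b, M x y → F (x, b) = (y, b) := by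
    intro x y b h
    have h' : ∃ y, M x y := ⟨y, h⟩
    have : F (x, b) = (h'.choose, b) := dif_pos h'
    rw [this, hu _ _ _ h'.choose_spec h]
  have hF2 : ∀ x b, (¬ ∃ y, M x y) → F (x, b) = (x, !b) := fun x b h => dif_neg h
  have hFF : ∀ q, F (F q) = q := by
    rintro ⟨x, b⟩
    by_cases h : ∃ y, M x y
    · obtain ⟨y, h⟩ := h
      rw [hF1 _ _ _ h, hF1 _ _ _ (hsy _ _ h)]
    · rw [hF2 _ _ h, hF2 _ _ h, Bool.not_not]
  refine ⟨⟨F, F, hFF, hFF⟩, hFF, ?_, fun x y h => hF1 x y _ h⟩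
  rintro ⟨x, b⟩ hq
  change F (x, b) = _ at hq
  by_cases h : ∃ y, M x y
  · obtain ⟨y, h⟩ := h
    rw [hF1 _ _ _ h] at hq
    have : y = x := congrArg Prod.fst hq
    exact hir x (this ▸ h)
  · rw [hF2 _ _ h] at hq
    have : (!b) = b := congrArg Prod.snd hq
    simp at this

lemma two_match {V : Type*} (M N : V → V → Prop) (hM : ∀ x y, M x y → M y x)
    (hM' : ∀ x, ¬ M x x) (uM : ∀ x y z, M x y → M x z → y = z)
    (hN : ∀ x y, N x y → N y x)
    (hN' : ∀ x, ¬ N x x) (uN : ∀ x y z, N x y → N x z → y = z) :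
    ∃ f : V → Bool, ∀ x y, M x y ∨ N x y → f x ≠ f y := by
  obtain ⟨s, s1, s2, s3⟩ := match_perm M hM hM' uM
  obtain ⟨t, t1, t2, t3⟩ := match_perm N hN hN' uN
  obtain ⟨f, hf⟩ := two_invol s t s1 t1 s2 t2
  refine ⟨fun x => f (x, true), fun x y h => ?_⟩
  rcases h with h | h
  · have := (hf (x, true)).1
    rw [s3 _ _ h] at this
    exact this.symm
  · have := (hf (x, true)).2
    rw [t3 _ _ h] at this
    exact this.symm

/-- Partial packing states: `1`, `2` are the packing colours, `0`, `3` the vertices left for the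
bipartite part (`3` for special leaves) and `4` the vertices not yet treated. -/
structure PInv {V : Type*} (G : SimpleGraph V) (g : V → ℕ) : Prop where
  rg : ∀ v, g v ≤ 4
  cl : ∀ u v, TAdj G u v → g u ≠ 4 → g v ≠ 4
  pk : ∀ u v, u ≠ v → g u = g v → (g u = 1 ∨ g u = 2) → ¬ G.Adj u v
  pk2 : ∀ w u v, u ≠ v → g u = g v → (g u = 1 ∨ g u = 2) → G.Adj w u → G.Adj w v → False
  bd : ∀ v w, g v ≠ 4 → g w = 4 → G.Adj v w → g v = 0
  bd2 : ∀ v w x y, g v ≠ 4 → g w = 4 → G.Adj v w → G.Adj v x → G.Adj v y →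
    g x = 1 → g y = 2 → False
  ma : ∀ v x y, g v = 0 → TAdj G v x → TAdj G v y → g x = 0 → g y = 0 → x = y
  lf : ∀ v x y, g v = 3 → G.Adj v x → G.Adj v y → (g x = 0 ∨ g x = 3) → (g y = 0 ∨ g y = 3) →
    x = y
  ll : ∀ u v, g u = 3 → g v = 3 → ¬ G.Adj u v

lemma two_lt_edist {V : Type*} (G : SimpleGraph V) {u v : V} (hne : u ≠ v) (h1 : ¬ G.Adj u v)
    (h2 : ∀ w, G.Adj w u → G.Adj w v → False) : 2 < G.edist u v := by
  by_contra hle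
  rw [not_lt] at hle
  have hr : G.edist u v ≠ ⊤ := by
    intro h; rw [h] at hle; simp at hle
  obtain ⟨p, hp⟩ := SimpleGraph.exists_walk_of_edist_ne_top hr
  rw [← hp] at hle
  have hle : p.length ≤ 2 := by exact_mod_cast hle
  cases p with
  | nil => exact hne rfl
  | cons h q =>
    cases q with
    | nil => exact h1 h
    | cons h' q' =>
      cases q' with
      | nil => exact h2 _ h.symm h'
      | cons h'' q'' => simp at hle

lemma finish {V : Type*} [Fintype V] [DecidableEq V]
    (G : SimpleGraph V) [DecidableRel G.Adj]
    (hcubic : ∀ v : V, G.degree v = 3) (hclawfree : IsClawFree G) (g : V → ℕ) (hg : PInv G g)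
    (h4 : ∀ v, g v ≠ 4) : ∃ f : V → Fin 4, IsColoring1122 G f := by
  classical
  have hsy : ∀ u v, G.Adj u v → G.Adj v u := fun u v h => h.symm
  have hir : ∀ u v, G.Adj u v → u ≠ v := fun u v h => h.ne
  obtain ⟨f, hf⟩ := two_match (fun x y => TAdj G x y ∧ g x = 0 ∧ g y = 0)
    (fun x y => G.Adj x y ∧ ¬ TAdj G x y)
    (fun x y h => ⟨h.1.symm, h.2.2, h.2.1⟩)
    (fun x h => hir _ _ h.1.1 rfl)
    (fun x y z h h' => hg.ma x y z h.2.1 h.1 h'.1 h.2.2 h'.2.2)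
    (fun x y h => ⟨h.1.symm, fun h' => h.2 h'.symm⟩)
    (fun x h => hir _ _ h.1 rfl)
    (fun x y z h h' => outer_unique G hcubic hclawfree h.1 h'.1 h.2 h'.2)
  let e : V → Bool := fun v =>
    if g v = 3 then (if h : ∃ x, G.Adj v x ∧ g x = 0 then !(f h.choose) else true) else f v
  have he : ∀ u v, G.Adj u v → g u = 0 → g v = 0 → e u ≠ e v := by
    intro u v huv hu hv
    have : f u ≠ f v := by
      apply hf
      by_cases ht : TAdj G u v
      · exact Or.inl ⟨ht, hu, hv⟩
      · exact Or.inr ⟨huv, ht⟩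
    simpa [e, hu, hv] using this
  have he3 : ∀ u v, G.Adj u v → g u = 3 → g v = 0 → e u ≠ e v := by
    intro u v huv hu hv
    have hh : ∃ x, G.Adj u x ∧ g x = 0 := ⟨v, huv, hv⟩
    have h1 : e u = !(f hh.choose) := by
      simp only [e, hu, if_true]
      exact dif_pos hh
    have h2 : hh.choose = v := hg.lf u _ _ hu hh.choose_spec.1 huv (Or.inl hh.choose_spec.2)
      (Or.inl hv)
    have h3 : e v = f v := by simp [e, hv]
    rw [h1, h2, h3]
    simp
  have hee : ∀ u v, G.Adj u v → (g u = 0 ∨ g u = 3) → (g v = 0 ∨ g v = 3) → e u ≠ e v := by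
    intro u v huv hu hv
    rcases hu with hu | hu <;> rcases hv with hv | hv
    · exact he u v huv hu hv
    · exact (he3 v u huv.symm hv hu).symm
    · exact he3 u v huv hu hv
    · exact absurd huv (hg.ll u v hu hv)
  let F : V → Fin 4 := fun v => if g v = 1 then 2 else if g v = 2 then 3 else
    if e v then 0 else 1
  have F0 : ∀ v, F v = 0 → (g v = 0 ∨ g v = 3) ∧ e v = true := by
    intro v hv
    have := hg.rg v
    have := h4 v
    simp only [F] at hv
    split_ifs at hv <;> first | (exact absurd hv (by decide)) | (refine ⟨by omega, by simp_all⟩)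
  have F1 : ∀ v, F v = 1 → (g v = 0 ∨ g v = 3) ∧ e v = false := by
    intro v hv
    have := hg.rg v
    have := h4 v
    simp only [F] at hv
    split_ifs at hv <;> first | (exact absurd hv (by decide)) | (refine ⟨by omega, by simp_all⟩)
  have F2 : ∀ v, F v = 2 → g v = 1 := by
    intro v hv
    simp only [F] at hv
    split_ifs at hv <;> simp_all
  have F3 : ∀ v, F v = 3 → g v = 2 := by
    intro v hv
    simp only [F] at hv
    split_ifs at hv <;> simp_all
  refine ⟨F, ?_, ?_, ?_, ?_⟩
  · intro u v hu hv huv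
    exact hee u v huv (F0 u hu).1 (F0 v hv).1 ((F0 u hu).2.trans (F0 v hv).2.symm)
  · intro u v hu hv huv
    exact hee u v huv (F1 u hu).1 (F1 v hv).1 ((F1 u hu).2.trans (F1 v hv).2.symm)
  · intro u v hne hu hv
    have hu := F2 u hu
    have hv := F2 v hv
    exact two_lt_edist G hne (hg.pk u v hne (hu.trans hv.symm) (Or.inl hu))
      (fun w => hg.pk2 w u v hne (hu.trans hv.symm) (Or.inl hu))
  · intro u v hne hu hv
    have hu := F3 u hu
    have hv := F3 v hv
    exact two_lt_edist G hne (hg.pk u v hne (hu.trans hv.symm) (Or.inr hu))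
      (fun w => hg.pk2 w u v hne (hu.trans hv.symm) (Or.inr hu))

lemma combine {V : Type*} (G : SimpleGraph V)
    (houter : ∀ v x y, G.Adj v x → G.Adj v y → ¬ TAdj G v x → ¬ TAdj G v y → x = y)
    (g g' : V → ℕ) (hg : PInv G g) (U : V → Prop)
    (hout : ∀ x, ¬ U x → g' x = g x) (u4 : ∀ x, U x → g x = 4) (u3 : ∀ x, U x → g' x ≤ 3)
    (ucl : ∀ x y, U x → TAdj G x y → U y)
    (L1 : ∀ u v, U u → U v → G.Adj u v → g' u = g' v → (g' u = 1 ∨ g' u = 2) → False)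
    (L2 : ∀ w u v, U w → U u → U v → u ≠ v → G.Adj w u → G.Adj w v → g' u = g' v →
      (g' u = 1 ∨ g' u = 2) → False)
    (L3 : ∀ w u v, U u → ¬ U w → g w ≠ 4 → G.Adj u w → G.Adj w v → ¬ U v → g' u = g v →
      (g' u = 1 ∨ g' u = 2) → False)
    (L4 : ∀ v w, U v → ¬ U w → g w = 4 → G.Adj v w → g' v = 0)
    (L5 : ∀ v w x y, U v → ¬ U w → G.Adj v w → G.Adj v x → G.Adj v y → U x → U y →
      g' x = 1 → g' y = 2 → False)
    (L6 : ∀ v x y, U v → U x → U y → TAdj G v x → TAdj G v y → g' v = 0 → g' x = 0 →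
      g' y = 0 → x = y)
    (L7 : ∀ v x, U v → g' v = 3 → G.Adj v x → U x)
    (L7' : ∀ v x y, U v → g' v = 3 → G.Adj v x → G.Adj v y → U x → U y →
      (g' x = 0 ∨ g' x = 3) → (g' y = 0 ∨ g' y = 3) → x = y)
    (L8 : ∀ u v, U u → U v → g' u = 3 → g' v = 3 → ¬ G.Adj u v) : PInv G g' := by
  have hsy : ∀ u v, G.Adj u v → G.Adj v u := fun u v h => h.symm
  have hnb : ∀ u v, U u → ¬ U v → G.Adj u v → g' v = 0 ∨ g' v = 4 := by
    intro u v hu hv h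
    rw [hout v hv]
    by_cases h4 : g v = 4
    · exact Or.inr h4
    · exact Or.inl (hg.bd v u h4 (u4 u hu) h.symm)
  have hT : ∀ u v, U u → ¬ U v → ¬ TAdj G v u := fun u v hu hv h => hv (ucl u v hu h.symm)
  constructor
  · intro v
    by_cases hv : U v
    · exact (u3 v hv).trans (by norm_num)
    · rw [hout v hv]; exact hg.rg v
  · intro u v ht hu
    by_cases hv : U v
    · have := u3 v hv; omega
    · have hu' : ¬ U u := fun h => hv (ucl u v h ht)
      rw [hout v hv]; rw [hout u hu'] at hu
      exact hg.cl u v ht hu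
  · intro u v hne he hc ha
    by_cases hu : U u <;> by_cases hv : U v
    · exact L1 u v hu hv ha he hc
    · have := hnb u v hu hv ha; omega
    · have := hnb v u hv hu ha.symm; omega
    · rw [hout u hu, hout v hv] at *
      exact hg.pk u v hne he hc ha
  · intro w u v hne he hc hu hv
    by_cases Uw : U w
    · by_cases Uu : U u
      · by_cases Uv : U v
        · exact L2 w u v Uw Uu Uv hne hu hv he hc
        · have := hnb w v Uw Uv hv; omega
      · have := hnb w u Uw Uu hu; omega
    · by_cases Uu : U u <;> by_cases Uv : U v
      · exact hne (houter w u v hu hv (hT u w Uu Uw) (hT v w Uv Uw))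
      · by_cases w4 : g w = 4
        · have h1 := hout v Uv
          have := hg.bd v w (by omega) w4 hv.symm
          omega
        · exact L3 w u v Uu Uw w4 hu.symm hv Uv (by rw [he, hout v Uv]) hc
      · by_cases w4 : g w = 4
        · have h1 := hout u Uu
          have := hg.bd u w (by omega) w4 hu.symm
          omega
        · exact L3 w v u Uv Uw w4 hv.symm hu Uu (by rw [← he, hout u Uu]) (by omega)
      · rw [hout u Uu, hout v Uv] at *
        exact hg.pk2 w u v hne he hc hu hv
  · intro v w hv hw ha
    have Uw : ¬ U w := fun h => by have := u3 w h; omega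
    rw [hout w Uw] at hw
    by_cases Uv : U v
    · exact L4 v w Uv Uw hw ha
    · rw [hout v Uv] at *
      exact hg.bd v w hv hw ha
  · intro v w x y hv hw ha hx hy gx gy
    have Uw : ¬ U w := fun h => by have := u3 w h; omega
    by_cases Uv : U v
    · by_cases Ux : U x
      · by_cases Uy : U y
        · exact L5 v w x y Uv Uw ha hx hy Ux Uy gx gy
        · have := hnb v y Uv Uy hy; omega
      · have := hnb v x Uv Ux hx; omega
    · rw [hout w Uw] at hw
      rw [hout v Uv] at hv
      have key : ∀ z, G.Adj v z → ¬ U z := by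
        intro z hz Uz
        have : z = w := houter v z w hz ha (hT z v Uz Uv) (fun h => hg.cl v w h hv hw)
        exact Uw (this ▸ Uz)
      rw [hout x (key x hx)] at gx
      rw [hout y (key y hy)] at gy
      exact hg.bd2 v w x y hv hw ha hx hy gx gy
  · intro v x y gv hx hy gx gy
    by_cases Uv : U v
    · exact L6 v x y Uv (ucl v x Uv hx) (ucl v y Uv hy) hx hy gv gx gy
    · have Ux : ¬ U x := fun h => hT x v h Uv hx
      have Uy : ¬ U y := fun h => hT y v h Uv hy
      rw [hout v Uv] at gv
      rw [hout x Ux] at gx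
      rw [hout y Uy] at gy
      exact hg.ma v x y gv hx hy gx gy
  · intro v x y gv hx hy gx gy
    by_cases Uv : U v
    · exact L7' v x y Uv gv hx hy (L7 v x Uv gv hx) (L7 v y Uv gv hy) gx gy
    · have key : ∀ z, G.Adj v z → ¬ U z := by
        intro z hz Uz
        have := hnb z v Uz Uv hz.symm
        omega
      rw [hout v Uv] at gv
      rw [hout x (key x hx)] at gx
      rw [hout y (key y hy)] at gy
      exact hg.lf v x y gv hx hy gx gy
  · intro u v gu gv ha
    by_cases Uu : U u
    · exact L8 u v Uu (L7 u v Uu gu ha) gu gv ha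
    · have Uv : ¬ U v := fun h => Uu (L7 v u h gv ha.symm)
      rw [hout u Uu] at gu
      rw [hout v Uv] at gv
      exact hg.ll u v gu gv ha

lemma free_color {V : Type*} (G : SimpleGraph V) (g : V → ℕ) (hg : PInv G g) {w w' : V}
    (hw : g w = 4) (hw' : g w' ≠ 4) (ha : G.Adj w' w) :
    ∃ c d, (c = 1 ∧ d = 2 ∨ c = 2 ∧ d = 1) ∧ ∀ x, G.Adj w' x → g x ≠ c := by
  by_cases h1 : ∃ x, G.Adj w' x ∧ g x = 1
  · obtain ⟨x, hx, gx⟩ := h1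
    exact ⟨2, 1, by simp, fun y hy gy => hg.bd2 w' w x y hw' hw ha hx hy gx gy⟩
  · exact ⟨1, 2, by simp, fun y hy gy => h1 ⟨y, hy, gy⟩⟩

lemma step_tri {V : Type*} [DecidableEq V] (G : SimpleGraph V)
    (houter : ∀ v x y, G.Adj v x → G.Adj v y → ¬ TAdj G v x → ¬ TAdj G v y → x = y)
    (g : V → ℕ) (hg : PInv G g)
    {w p q w' p' q' : V} (h : Tri G w p q w' p' q') (hw : g w = 4) (hw' : g w' ≠ 4) :
    ∃ g' : V → ℕ, PInv G g' ∧ (∀ x, g x ≠ 4 → g' x ≠ 4) ∧ g' w ≠ 4 := by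
  obtain ⟨wp, wq, pq, Nw, Np, Nq, Tw, Tp, Tq, ow, op, oq⟩ := h
  have hp : g p = 4 := by
    by_contra h4; exact hg.cl p w ((Tp w).2 (Or.inl rfl)) h4 hw
  have hq : g q = 4 := by
    by_contra h4; exact hg.cl q w ((Tq w).2 (Or.inl rfl)) h4 hw
  obtain ⟨c, d, hc, hc'⟩ := free_color G g hg hw hw' ((Nw w').2 (by simp)).symm
  obtain ⟨g', g1, g2, g3, gout⟩ : ∃ g' : V → ℕ, g' w = c ∧ g' p = 0 ∧ g' q = 0 ∧
      ∀ x, ¬ (x = w ∨ x = p ∨ x = q) → g' x = g x :=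
    ⟨fun x => if x = w then c else if x = p then 0 else if x = q then 0 else g x, by grind⟩
  refine ⟨g', combine G houter g g' hg (fun x => x = w ∨ x = p ∨ x = q) gout
    ?_ ?_ ?_ ?_ ?_ ?_ ?_ ?_ ?_ ?_ ?_ ?_, by grind, by grind⟩
  all_goals clear houter hg
  · grind
  · grind
  · grind
  · grind
  · grind
  · grind
  · grind
  · grind
  · grind
  · grind
  · grind
  · grind

lemma step_dia {V : Type*} [DecidableEq V] (G : SimpleGraph V)
    (houter : ∀ v x y, G.Adj v x → G.Adj v y → ¬ TAdj G v x → ¬ TAdj G v y → x = y)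
    (g : V → ℕ) (hg : PInv G g)
    {a m n b a' b' : V} (h : Dia G a m n b a' b') (ha : g a = 4) (ha' : g a' ≠ 4) :
    ∃ g' : V → ℕ, PInv G g' ∧ (∀ x, g x ≠ 4 → g' x ≠ 4) ∧ g' a ≠ 4 := by
  obtain ⟨am, an, ab, mn, mb, nb, Na, Nm, Nn, Nb, Ta, Tm, Tn, Tb, oa, ob⟩ := h
  have hm : g m = 4 := by
    by_contra h4; exact hg.cl m a ((Tm a).2 (Or.inl rfl)) h4 ha
  have hn : g n = 4 := by
    by_contra h4; exact hg.cl n a ((Tn a).2 (Or.inl rfl)) h4 ha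
  have hb : g b = 4 := by
    by_contra h4; exact hg.cl b m ((Tb m).2 (Or.inl rfl)) h4 hm
  obtain ⟨c, d, hc, hc'⟩ := free_color G g hg ha ha' ((Na a').2 (by simp)).symm
  obtain ⟨g', g1, g2, g3, g4, gout⟩ : ∃ g' : V → ℕ, g' a = c ∧ g' m = d ∧ g' n = 0 ∧ g' b = 0 ∧
      ∀ x, ¬ (x = a ∨ x = m ∨ x = n ∨ x = b) → g' x = g x :=
    ⟨fun x => if x = a then c else if x = m then d else if x = n then 0 else if x = b then 0
      else g x, by grind⟩
  refine ⟨g', combine G houter g g' hg (fun x => x = a ∨ x = m ∨ x = n ∨ x = b) gout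
    ?_ ?_ ?_ ?_ ?_ ?_ ?_ ?_ ?_ ?_ ?_ ?_, by grind, by grind⟩
  all_goals clear houter hg
  · grind
  · grind
  · grind
  · grind
  · grind
  · grind
  · grind
  · grind
  · grind
  · grind
  · grind
  · grind

lemma step_four {V : Type*} [DecidableEq V] (G : SimpleGraph V)
    (houter : ∀ v x y, G.Adj v x → G.Adj v y → ¬ TAdj G v x → ¬ TAdj G v y → x = y)
    (g : V → ℕ) (hg : PInv G g)
    {a b c d : V} (h : Kfour G a b c d) (ha : g a = 4)
    (hcl : ∀ x y, G.Adj x y → g x = 4 → g y = 4) :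
    ∃ g' : V → ℕ, PInv G g' ∧ (∀ x, g x ≠ 4 → g' x ≠ 4) ∧ g' a ≠ 4 := by
  obtain ⟨ab, ac, ad, bc, bd, cd, Na, Nb, Nc, Nd⟩ := h
  have hb : g b = 4 := hcl a b ((Na b).2 (by simp)) ha
  have hc : g c = 4 := hcl a c ((Na c).2 (by simp)) ha
  have hd : g d = 4 := hcl a d ((Na d).2 (by simp)) ha
  obtain ⟨g', g1, g2, g3, g4, gout⟩ : ∃ g' : V → ℕ, g' a = 1 ∧ g' b = 2 ∧ g' c = 0 ∧ g' d = 0 ∧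
      ∀ x, ¬ (x = a ∨ x = b ∨ x = c ∨ x = d) → g' x = g x :=
    ⟨fun x => if x = a then 1 else if x = b then 2 else if x = c then 0 else if x = d then 0
      else g x, by grind⟩
  have hTA : ∀ u v, TAdj G u v → G.Adj u v := fun u v h => h.1
  refine ⟨g', combine G houter g g' hg (fun x => x = a ∨ x = b ∨ x = c ∨ x = d) gout
    ?_ ?_ ?_ ?_ ?_ ?_ ?_ ?_ ?_ ?_ ?_ ?_, by grind, by grind⟩
  all_goals clear houter hg hcl
  · grind
  · grind
  · grind
  · grind
  · grind
  · grind
  · grind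
  · grind
  · grind
  · grind
  · grind
  · grind

lemma root_tri_tri {V : Type*} [DecidableEq V] (G : SimpleGraph V)
    (houter : ∀ v x y, G.Adj v x → G.Adj v y → ¬ TAdj G v x → ¬ TAdj G v y → x = y)
    (g : V → ℕ) (hg : PInv G g)
    {w p q z p' q' r s z' r' s' : V} (h : Tri G w p q z p' q') (h' : Tri G z r s z' r' s')
    (hw : g w = 4) (hcl : ∀ x y, G.Adj x y → g x = 4 → g y = 4) :
    ∃ g' : V → ℕ, PInv G g' ∧ (∀ x, g x ≠ 4 → g' x ≠ 4) ∧ g' w ≠ 4 := by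
  have hTs : ∀ u v, TAdj G u v → TAdj G v u := fun u v h => h.symm
  have hwz : G.Adj w z := (h.Nw z).2 (by simp)
  obtain ⟨wp, wq, pq, Nw, Np, Nq, Tw, Tp, Tq, ow, op, oq⟩ := h
  obtain ⟨zr, zs, rs, Nz, Nr, Ns, Tz, Tr, Ts, oz, or, os⟩ := h'
  have hp : g p = 4 := hcl w p ((Nw p).2 (by simp)) hw
  have hq : g q = 4 := hcl w q ((Nw q).2 (by simp)) hw
  have hz : g z = 4 := hcl w z hwz hw
  have hr : g r = 4 := hcl z r ((Nz r).2 (by simp)) hz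
  have hs : g s = 4 := hcl z s ((Nz s).2 (by simp)) hz
  have d1 : r ≠ w ∧ r ≠ p ∧ r ≠ q := by
    have := Tr z
    refine ⟨?_, ?_, ?_⟩ <;> rintro rfl <;> grind
  have d2 : s ≠ w ∧ s ≠ p ∧ s ≠ q := by
    have := Ts z
    refine ⟨?_, ?_, ?_⟩ <;> rintro rfl <;> grind
  have hz' : z' = w := by
    have := (Nz w).1 hwz.symm
    grind
  obtain ⟨g', g1, g2, g3, g4, g5, g6, gout⟩ : ∃ g' : V → ℕ, g' w = 1 ∧ g' p = 0 ∧ g' q = 0 ∧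
      g' z = 2 ∧ g' r = 0 ∧ g' s = 0 ∧
      ∀ x, ¬ (x = w ∨ x = p ∨ x = q ∨ x = z ∨ x = r ∨ x = s) → g' x = g x :=
    ⟨fun x => if x = w then 1 else if x = z then 2 else
      if x = p ∨ x = q ∨ x = r ∨ x = s then 0 else g x, by grind⟩
  refine ⟨g', combine G houter g g' hg (fun x => x = w ∨ x = p ∨ x = q ∨ x = z ∨ x = r ∨ x = s) gout
    ?_ ?_ ?_ ?_ ?_ ?_ ?_ ?_ ?_ ?_ ?_ ?_, by grind, by grind⟩
  all_goals clear houter hg hTs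
  · grind (splits := 25)
  · grind (splits := 25)
  · grind (splits := 25)
  · grind (splits := 25)
  · grind (splits := 25)
  · grind (splits := 25)
  · grind (splits := 25)
  · grind (splits := 25)
  · grind (splits := 25)
  · grind (splits := 25)
  · grind (splits := 25)
  · grind (splits := 25)

lemma root_dia_tri {V : Type*} [DecidableEq V] (G : SimpleGraph V)
    (houter : ∀ v x y, G.Adj v x → G.Adj v y → ¬ TAdj G v x → ¬ TAdj G v y → x = y)
    (g : V → ℕ) (hg : PInv G g)
    {a m n b z b' r s z' r' s' : V} (h : Dia G a m n b z b') (h' : Tri G z r s z' r' s')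
    (ha : g a = 4) (hcl : ∀ x y, G.Adj x y → g x = 4 → g y = 4) :
    ∃ g' : V → ℕ, PInv G g' ∧ (∀ x, g x ≠ 4 → g' x ≠ 4) ∧ g' a ≠ 4 ∧ g' m ≠ 4 ∧ g' z ≠ 4 := by
  have hTs : ∀ u v, TAdj G u v → TAdj G v u := fun u v h => h.symm
  have haz : G.Adj a z := (h.Na z).2 (by simp)
  obtain ⟨am, an, ab, mn, mb, nb, Na, Nm, Nn, Nb, Ta, Tm, Tn, Tb, oa, ob⟩ := h
  obtain ⟨zr, zs, rs, Nz, Nr, Ns, Tz, Tr, Ts, oz, or, os⟩ := h'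
  have hm : g m = 4 := hcl a m ((Na m).2 (by simp)) ha
  have hn : g n = 4 := hcl a n ((Na n).2 (by simp)) ha
  have hb : g b = 4 := hcl m b ((Nm b).2 (by simp)) hm
  have hz : g z = 4 := hcl a z haz ha
  have hr : g r = 4 := hcl z r ((Nz r).2 (by simp)) hz
  have hs : g s = 4 := hcl z s ((Nz s).2 (by simp)) hz
  have d1 : r ≠ a ∧ r ≠ m ∧ r ≠ n ∧ r ≠ b := by
    have := Tr z
    refine ⟨?_, ?_, ?_, ?_⟩ <;> rintro rfl <;> grind
  have d2 : s ≠ a ∧ s ≠ m ∧ s ≠ n ∧ s ≠ b := by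
    have := Ts z
    refine ⟨?_, ?_, ?_, ?_⟩ <;> rintro rfl <;> grind
  have hz' : z' = a := by
    have := (Nz a).1 haz.symm
    grind
  obtain ⟨g', g1, g2, g3, g4, g5, g6, g7, gout⟩ : ∃ g' : V → ℕ, g' a = 3 ∧ g' m = 1 ∧ g' n = 0 ∧
      g' b = 0 ∧ g' z = 2 ∧ g' r = 0 ∧ g' s = 0 ∧
      ∀ x, ¬ (x = a ∨ x = m ∨ x = n ∨ x = b ∨ x = z ∨ x = r ∨ x = s) → g' x = g x :=
    ⟨fun x => if x = a then 3 else if x = m then 1 else if x = z then 2 else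
      if x = n ∨ x = b ∨ x = r ∨ x = s then 0 else g x, by grind⟩
  refine ⟨g', combine G houter g g' hg
    (fun x => x = a ∨ x = m ∨ x = n ∨ x = b ∨ x = z ∨ x = r ∨ x = s) gout
    ?_ ?_ ?_ ?_ ?_ ?_ ?_ ?_ ?_ ?_ ?_ ?_, by grind, by grind⟩
  all_goals clear houter hg hTs
  · grind (splits := 25)
  · grind (splits := 25)
  · grind (splits := 25)
  · grind (splits := 25)
  · grind (splits := 25)
  · grind (splits := 25)
  · grind (splits := 25)
  · grind (splits := 25)
  · grind (splits := 25)
  · grind (splits := 25)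
  · grind (splits := 25)
  · grind (splits := 25)

lemma root_dia_dia {V : Type*} [DecidableEq V] (G : SimpleGraph V)
    (houter : ∀ v x y, G.Adj v x → G.Adj v y → ¬ TAdj G v x → ¬ TAdj G v y → x = y)
    (g : V → ℕ) (hg : PInv G g)
    {a m n b z b' r s t z' t' : V} (h : Dia G a m n b z b') (h' : Dia G z r s t z' t')
    (ha : g a = 4) (hcl : ∀ x y, G.Adj x y → g x = 4 → g y = 4) :
    ∃ g' : V → ℕ, PInv G g' ∧ (∀ x, g x ≠ 4 → g' x ≠ 4) ∧ g' a ≠ 4 ∧ g' m ≠ 4 ∧ g' z ≠ 4 := by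
  have hTs : ∀ u v, TAdj G u v → TAdj G v u := fun u v h => h.symm
  have haz : G.Adj a z := (h.Na z).2 (by simp)
  obtain ⟨am, an, ab, mn, mb, nb, Na, Nm, Nn, Nb, Ta, Tm, Tn, Tb, oa, ob⟩ := h
  obtain ⟨zr, zs, zt, rs, rt, st, Nz, Nr, Ns, Nt, Tz, Tr, Ts, Tt, oz, ot⟩ := h'
  have hm : g m = 4 := hcl a m ((Na m).2 (by simp)) ha
  have hn : g n = 4 := hcl a n ((Na n).2 (by simp)) ha
  have hb : g b = 4 := hcl m b ((Nm b).2 (by simp)) hm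
  have hz : g z = 4 := hcl a z haz ha
  have hr : g r = 4 := hcl z r ((Nz r).2 (by simp)) hz
  have hs : g s = 4 := hcl z s ((Nz s).2 (by simp)) hz
  have ht : g t = 4 := hcl r t ((Nr t).2 (by simp)) hr
  have d1 : r ≠ a ∧ r ≠ m ∧ r ≠ n ∧ r ≠ b := by
    have := Tr z
    refine ⟨?_, ?_, ?_, ?_⟩ <;> rintro rfl <;> grind
  have d2 : s ≠ a ∧ s ≠ m ∧ s ≠ n ∧ s ≠ b := by
    have := Ts z
    refine ⟨?_, ?_, ?_, ?_⟩ <;> rintro rfl <;> grind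
  have d3 : t ≠ a ∧ t ≠ m ∧ t ≠ n ∧ t ≠ b := by
    have := Tt r
    refine ⟨?_, ?_, ?_, ?_⟩ <;> rintro rfl <;> grind
  have hz' : z' = a := by
    have := (Nz a).1 haz.symm
    grind
  have e1 : b' ≠ r := by
    rintro rfl
    have h1 : G.Adj b b' := (Nb b').2 (by simp)
    have := (Nr b).1 h1.symm
    grind
  have e2 : t' ≠ m := by
    rintro rfl
    have h1 : G.Adj t t' := (Nt t').2 (by simp)
    have := (Nm t).1 h1.symm
    grind
  obtain ⟨g', g1, g2, g3, g4, g5, g6, g7, g8, gout⟩ : ∃ g' : V → ℕ, g' a = 3 ∧ g' m = 1 ∧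
      g' n = 0 ∧ g' b = 0 ∧ g' z = 2 ∧ g' r = 1 ∧ g' s = 0 ∧ g' t = 0 ∧
      ∀ x, ¬ (x = a ∨ x = m ∨ x = n ∨ x = b ∨ x = z ∨ x = r ∨ x = s ∨ x = t) → g' x = g x :=
    ⟨fun x => if x = a then 3 else if x = m ∨ x = r then 1 else if x = z then 2 else
      if x = n ∨ x = b ∨ x = s ∨ x = t then 0 else g x, by grind⟩
  refine ⟨g', combine G houter g g' hg
    (fun x => x = a ∨ x = m ∨ x = n ∨ x = b ∨ x = z ∨ x = r ∨ x = s ∨ x = t) gout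
    ?_ ?_ ?_ ?_ ?_ ?_ ?_ ?_ ?_ ?_ ?_ ?_, by grind, by grind⟩
  all_goals clear houter hg hTs
  · grind (splits := 25)
  · grind (splits := 25)
  · grind (splits := 25)
  · grind (splits := 25)
  · grind (splits := 25)
  · grind (splits := 25)
  · grind (splits := 25)
  · grind (splits := 25)
  · grind (splits := 25)
  · grind (splits := 25)
  · grind (splits := 25)
  · grind (splits := 25)

lemma Kfour.no_outer {V : Type*} {G : SimpleGraph V} {a b c d x : V} (h : Kfour G a b c d)
    (hx : G.Adj a x) : TAdj G a x := by
  obtain ⟨h1, h2, h3, h4, h5, h6, h7, h8, h9, h10⟩ := h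
  refine ⟨hx, ?_⟩
  rcases (h7 x).1 hx with rfl | rfl | rfl
  · exact ⟨c, by grind⟩
  · exact ⟨b, by grind⟩
  · exact ⟨b, by grind⟩

lemma root_dia {V : Type*} [Fintype V] [DecidableEq V] (G : SimpleGraph V) [DecidableRel G.Adj]
    (hcubic : ∀ v : V, G.degree v = 3) (hclawfree : IsClawFree G)
    (g : V → ℕ) (hg : PInv G g)
    {a m n b z b' : V} (h : Dia G a m n b z b')
    (ha : g a = 4) (hcl : ∀ x y, G.Adj x y → g x = 4 → g y = 4) :
    ∃ g' : V → ℕ, PInv G g' ∧ (∀ x, g x ≠ 4 → g' x ≠ 4) ∧ g' a ≠ 4 ∧ g' m ≠ 4 ∧ g' z ≠ 4 := by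
  have houter := fun v x y => @outer_unique V _ _ G _ hcubic hclawfree v x y
  have haz : G.Adj z a := ((h.Na z).2 (by simp)).symm
  have hnt : ¬ TAdj G z a := by
    intro ht
    have := (h.Ta z).1 ht.symm
    have := h.oa
    tauto
  rcases unit_cases G hcubic hclawfree z with ⟨_, _, _, h'⟩ |
    ⟨z1, r, s, t, z', t', h', rfl | rfl⟩ | ⟨r, s, z', r', s', h'⟩
  · exact absurd (h'.no_outer haz) hnt
  · exact root_dia_dia G houter g hg h h' ha hcl
  · exact absurd ((h'.Tm a).2 ((h'.Nm a).1 haz)) hnt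
  · exact root_dia_tri G houter g hg h h' ha hcl

lemma step {V : Type*} [Fintype V] [DecidableEq V] (G : SimpleGraph V) [DecidableRel G.Adj]
    (hcubic : ∀ v : V, G.degree v = 3) (hclawfree : IsClawFree G)
    (g : V → ℕ) (hg : PInv G g) (h4 : ∃ v, g v = 4) :
    ∃ g' : V → ℕ, PInv G g' ∧ (∀ x, g x ≠ 4 → g' x ≠ 4) ∧ ∃ w, g w = 4 ∧ g' w ≠ 4 := by
  have houter := fun v x y => @outer_unique V _ _ G _ hcubic hclawfree v x y
  by_cases hcl : ∀ x y, G.Adj x y → g x = 4 → g y = 4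
  · obtain ⟨v, hv⟩ := h4
    rcases unit_cases G hcubic hclawfree v with ⟨_, _, _, h⟩ |
      ⟨a, m, n, b, a', b', h, rfl | rfl⟩ | ⟨p, q, z, p', q', h⟩
    · obtain ⟨g', h1, h2, h3⟩ := step_four G houter g hg h hv hcl
      exact ⟨g', h1, h2, v, hv, h3⟩
    · obtain ⟨g', h1, h2, h3, -⟩ := root_dia G hcubic hclawfree g hg h hv hcl
      exact ⟨g', h1, h2, v, hv, h3⟩
    · have ha : g a = 4 := hcl v a ((h.Nm a).2 (by simp)) hv
      obtain ⟨g', h1, h2, h3, -⟩ := root_dia G hcubic hclawfree g hg h ha hcl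
      exact ⟨g', h1, h2, a, ha, h3⟩
    · have hvz : G.Adj v z := (h.Nw z).2 (by simp)
      have hz : g z = 4 := hcl v z hvz hv
      have hnt : ¬ TAdj G z v := by
        intro ht
        have := (h.Tw z).1 ht.symm
        have := h.ow
        tauto
      rcases unit_cases G hcubic hclawfree z with ⟨_, _, _, h'⟩ |
        ⟨a, m, n, b, a', b', h', rfl | rfl⟩ | ⟨r, s, z', r', s', h'⟩
      · exact absurd (h'.no_outer hvz.symm) hnt
      · obtain ⟨g', h1, h2, h3, -⟩ := root_dia G hcubic hclawfree g hg h' hz hcl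
        exact ⟨g', h1, h2, z, hz, h3⟩
      · exact absurd ((h'.Tm v).2 ((h'.Nm v).1 hvz.symm)) hnt
      · obtain ⟨g', h1, h2, h3⟩ := root_tri_tri G houter g hg h h' hv hcl
        exact ⟨g', h1, h2, v, hv, h3⟩
  · push Not at hcl
    obtain ⟨w, v, hwv, hw, hv⟩ := hcl
    have hnt : ¬ TAdj G w v := fun ht => hg.cl v w ht.symm hv hw
    rcases unit_cases G hcubic hclawfree w with ⟨_, _, _, h⟩ |
      ⟨a, m, n, b, a', b', h, rfl | rfl⟩ | ⟨p, q, z, p', q', h⟩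
    · exact absurd (h.no_outer hwv) hnt
    · have : v = a' := by
        have h1 := (h.Na v).1 hwv
        have h2 := h.Ta v
        tauto
      obtain ⟨g', h1, h2, h3⟩ := step_dia G houter g hg h hw (this ▸ hv)
      exact ⟨g', h1, h2, w, hw, h3⟩
    · exact absurd ((h.Tm v).2 ((h.Nm v).1 hwv)) hnt
    · have : v = z := by
        have h1 := (h.Nw v).1 hwv
        have h2 := h.Tw v
        tauto
      obtain ⟨g', h1, h2, h3⟩ := step_tri G houter g hg h hw (this ▸ hv)
      exact ⟨g', h1, h2, w, hw, h3⟩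

lemma all_done {V : Type*} [Fintype V] [DecidableEq V] (G : SimpleGraph V) [DecidableRel G.Adj]
    (hcubic : ∀ v : V, G.degree v = 3) (hclawfree : IsClawFree G) :
    ∀ (k : ℕ) (g : V → ℕ), PInv G g → (Finset.univ.filter fun v => g v = 4).card = k →
      ∃ g' : V → ℕ, PInv G g' ∧ ∀ v, g' v ≠ 4 := by
  intro k
  induction k using Nat.strong_induction_on with
  | _ k ih =>
    intro g hg hk
    by_cases h4 : ∃ v, g v = 4
    · obtain ⟨g', h1, h2, w, h3, h5⟩ := step G hcubic hclawfree g hg h4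
      refine ih _ ?_ g' h1 rfl
      rw [← hk]
      apply Finset.card_lt_card
      rw [Finset.ssubset_iff_of_subset]
      · exact ⟨w, by simp [h3], by simp [h5]⟩
      · intro x hx
        simp only [Finset.mem_filter, Finset.mem_univ, true_and] at hx ⊢
        by_contra hx'
        exact h2 x hx' hx
    · exact ⟨g, hg, fun v hv => h4 ⟨v, hv⟩⟩

/-- Every claw-free cubic graph admits a `(1,1,2,2)`-packing coloring. -/
theorem clawfree_cubic_is_1122_colorable {V : Type*} [Fintype V] [DecidableEq V]
    (G : SimpleGraph V) [DecidableRel G.Adj]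
    (hcubic : ∀ v : V, G.degree v = 3) (hclawfree : IsClawFree G) :
    ∃ f : V → Fin 4, IsColoring1122 G f := by
  have h0 : PInv G (fun _ => 4) := by
    constructor <;> simp
  obtain ⟨g, hg, h4⟩ := all_done G hcubic hclawfree _ _ h0 rfl
  exact finish G hcubic hclawfree g hg h4
end

section
/- Every 2-edge-connected, claw-free cubic graph admits a (1,1,2,2)-packing coloring. -/
open SimpleGraph

namespace PC

/-- Two fixed-point-free involutions have a common proper 2-coloring. -/
theorem two_invol {W : Type*} (p q : Equiv.Perm W) (hp : ∀ x, p (p x) = x) (hq : ∀ x, q (q x) = x)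
    (hp' : ∀ x, p x ≠ x) (hq' : ∀ x, q x ≠ x) :
    ∃ f : W → Prop, ∀ x, (f (p x) ↔ ¬ f x) ∧ (f (q x) ↔ ¬ f x) := by
  classical
  have hpp : p * p = 1 := by ext x; simp [hp]
  have hqq : q * q = 1 := by ext x; simp [hq]
  have hpi : p⁻¹ = p := inv_eq_of_mul_eq_one_left hpp
  have hqi : q⁻¹ = q := inv_eq_of_mul_eq_one_left hqq
  have hconj : p * (p * q) * p⁻¹ = (p * q)⁻¹ := by
    rw [mul_inv_rev, hpi, hqi]; rw [← mul_assoc, hpp, one_mul]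
  have hz : ∀ m : ℤ, p * (p * q) ^ m = (p * q) ^ (-m) * p := by
    intro m
    have : p * (p * q) ^ m * p⁻¹ = (p * q) ^ (-m) := by
      rw [← conj_zpow, hconj, inv_zpow, zpow_neg]
    rw [← this]; simp
  have key : ∀ x, ¬ (p * q).SameCycle x (p x) := by
    rintro x ⟨k, hk⟩
    obtain ⟨m, rfl | rfl⟩ := Int.even_or_odd' k
    · apply hp' (((p * q) ^ m) x)
      have h1 : ((p * q) ^ (-m) * (p * q) ^ (2 * m)) x = ((p * q) ^ (-m) * p) x := by
        simp only [Equiv.Perm.mul_apply, hk]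
      rw [← hz, ← zpow_add] at h1
      have : -m + 2 * m = m := by ring
      rw [this] at h1
      simpa using h1.symm
    · apply hq' (((p * q) ^ m) x)
      have h1 : ((p * q) ^ (-m-1) * (p * q) ^ (2 * m + 1)) x = ((p * q) ^ (-m-1) * p) x := by
        simp only [Equiv.Perm.mul_apply, hk]
      have h2 : (p * q) ^ (-m-1) * p = q * (p * q) ^ m := by
        have : -m - 1 = -(m+1) := by ring
        rw [this, ← hz, zpow_add, zpow_one, (Commute.self_zpow (p*q) m).symm.eq,
          ← mul_assoc, ← mul_assoc, hpp, one_mul]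
      rw [h2, ← zpow_add] at h1
      have : -m - 1 + (2 * m + 1) = m := by ring
      rw [this] at h1
      simpa using h1.symm
  let s := Equiv.Perm.SameCycle.setoid (p * q)
  let _ : LinearOrder (Quotient s) := WellOrderingRel.isWellOrder.linearOrder
  have hne : ∀ x, (Quotient.mk s x) ≠ Quotient.mk s (p x) := fun x h => key x (Quotient.exact h)
  refine ⟨fun x => Quotient.mk s x < Quotient.mk s (p x), fun x => ?_⟩
  have e1 : Quotient.mk s (p (q x)) = Quotient.mk s x := by
    apply Quotient.sound
    exact (Equiv.Perm.SameCycle.symm ⟨1, by simp⟩)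
  have e2 : Quotient.mk s (q x) = Quotient.mk s (p x) := by
    apply Quotient.sound
    refine Equiv.Perm.SameCycle.symm ⟨-1, ?_⟩
    rw [zpow_neg_one, mul_inv_rev, hpi, hqi]; simp [hp]
  have := hne x
  constructor
  · simp only [hp]
    rw [not_lt]; exact ⟨le_of_lt, fun h => lt_of_le_of_ne h (Ne.symm this)⟩
  · simp only [e1, e2]
    rw [not_lt]; exact ⟨le_of_lt, fun h => lt_of_le_of_ne h (Ne.symm this)⟩

theorem invol_of_rel {V : Type*} (M : V → V → Prop) (hs : ∀ u v, M u v → M v u)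
    (hi : ∀ u, ¬ M u u) (hf : ∀ u v w, M u v → M u w → v = w) :
    ∃ p : Equiv.Perm (V × Bool), (∀ x, p (p x) = x) ∧ (∀ x, p x ≠ x) ∧
      ∀ u v i, M u v → p (u, i) = (v, i) := by
  classical
  let g : V × Bool → V × Bool := fun x =>
    if h : ∃ w, M x.1 w then (h.choose, x.2) else (x.1, !x.2)
  have g1 : ∀ u v i, M u v → g (u, i) = (v, i) := by
    intro u v i h
    have h' : ∃ w, M u w := ⟨v, h⟩
    simp only [g, dif_pos h']
    rw [hf u _ _ h'.choose_spec h]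
  have g2 : ∀ u i, (¬ ∃ w, M u w) → g (u, i) = (u, !i) := by
    intro u i h
    simp only [g, dif_neg h]
  have gg : ∀ x, g (g x) = x := by
    rintro ⟨u, i⟩
    by_cases h : ∃ w, M u w
    · obtain ⟨w, hw⟩ := h
      rw [g1 u w i hw, g1 w u i (hs _ _ hw)]
    · rw [g2 u i h, g2 u _ h]; simp
  refine ⟨⟨g, g, gg, gg⟩, gg, ?_, g1⟩
  rintro ⟨u, i⟩
  change g (u, i) ≠ (u, i)
  by_cases h : ∃ w, M u w
  · obtain ⟨w, hw⟩ := h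
    rw [g1 u w i hw]
    rintro h
    have : w = u := congrArg Prod.fst h
    subst this; exact hi _ hw
  · rw [g2 u i h]; simp

theorem two_matchings {V : Type*} (M N : V → V → Prop)
    (hMs : ∀ u v, M u v → M v u) (hMi : ∀ u, ¬ M u u) (hMf : ∀ u v w, M u v → M u w → v = w)
    (hNs : ∀ u v, N u v → N v u) (hNi : ∀ u, ¬ N u u) (hNf : ∀ u v w, N u v → N u w → v = w) :
    ∃ f : V → Prop, ∀ u v, (M u v ∨ N u v) → (f v ↔ ¬ f u) := by
  obtain ⟨p, p1, p2, p3⟩ := invol_of_rel M hMs hMi hMf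
  obtain ⟨q, q1, q2, q3⟩ := invol_of_rel N hNs hNi hNf
  obtain ⟨f, hf⟩ := two_invol p q p1 q1 p2 q2
  refine ⟨fun v => f (v, true), ?_⟩
  rintro u v (h | h)
  · have := (hf (u, true)).1
    rwa [p3 u v true h] at this
  · have := (hf (u, true)).2
    rwa [q3 u v true h] at this

theorem forest_color {V : Type*} (C : V → V → Prop) (ρ : V → ℕ)
    (hs : ∀ u v, C u v → C v u) (hρ : ∀ u v, C u v → ρ u ≠ ρ v)
    (hu : ∀ u v w, C u v → C u w → ρ v < ρ u → ρ w < ρ u → v = w) :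
    ∃ c : V → Prop, ∀ u v, C u v → (c v ↔ ¬ c u) := by
  classical
  let F : (u : V) → ((v : V) → ρ v < ρ u → Prop) → Prop := fun u rec =>
    if h : ∃ v, C u v ∧ ρ v < ρ u then ¬ rec h.choose h.choose_spec.2 else True
  let wf : WellFounded (fun a b : V => ρ a < ρ b) := (measure ρ).wf
  let c := wf.fix F
  have hc : ∀ u v, C u v → ρ v < ρ u → (c u ↔ ¬ c v) := by
    intro u v h1 h2
    have h : ∃ v, C u v ∧ ρ v < ρ u := ⟨v, h1, h2⟩
    have e : c u = F u (fun y _ => c y) := wf.fix_eq F u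
    rw [e]
    simp only [F, dif_pos h]
    rw [hu u _ v h.choose_spec.1 h1 h.choose_spec.2 h2]
  refine ⟨c, fun u v h => ?_⟩
  rcases lt_or_gt_of_ne (hρ u v h) with h1 | h1
  · exact hc v u (hs _ _ h) h1
  · have := hc u v h h1
    tauto

section
variable {V : Type*} (G : SimpleGraph V)

def Mid (v : V) : Prop := ∀ w, G.Adj v w → ∃ z, G.Adj v z ∧ G.Adj w z
def Tri (v : V) : Prop := ¬ Mid G v ∧ ∀ x, G.Adj v x → ¬ Mid G x
def SpT (key : V → ℕ) (v : V) : Prop :=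
  Tri G v ∧ ∀ x z, G.Adj v x → G.Adj v z → G.Adj x z → key v < key x
def Ptd (key : V → ℕ) (v : V) : Prop := ∃ c u, G.Adj v c ∧ G.Adj c u ∧ SpT G key u
def S (key : V → ℕ) (v : V) : Prop :=
  SpT G key v ∨ (Mid G v ∧ ((∀ b, Mid G b → G.Adj v b → key v < key b) ∨ ¬ Ptd G key v))

/-- Local structure hypothesis. -/
def Loc : Prop := ∀ v, ∃ x y w, x ≠ y ∧ x ≠ w ∧ y ≠ w ∧
    (∀ t, G.Adj v t ↔ t = x ∨ t = y ∨ t = w) ∧ G.Adj x y ∧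
    ((Mid G v ∧ G.Adj x w ∧ ¬ G.Adj y w) ∨ (¬ Mid G v ∧ ¬ G.Adj x w ∧ ¬ G.Adj y w))

variable {G}

theorem loc_of (hcub : ∀ v, ∃ a b c, a ≠ b ∧ a ≠ c ∧ b ≠ c ∧ ∀ t, G.Adj v t ↔ t = a ∨ t = b ∨ t = c)
    (hclaw : IsClawFree G)
    (hK : ∀ a b c d, G.Adj a b → G.Adj a c → G.Adj a d → G.Adj b c → G.Adj b d → G.Adj c d → False) :
    Loc G := by
  have step : ∀ v x y w, x ≠ y → x ≠ w → y ≠ w →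
      (∀ t, G.Adj v t ↔ t = x ∨ t = y ∨ t = w) → G.Adj x y →
      ∃ x y w, x ≠ y ∧ x ≠ w ∧ y ≠ w ∧
    (∀ t, G.Adj v t ↔ t = x ∨ t = y ∨ t = w) ∧ G.Adj x y ∧
    ((Mid G v ∧ G.Adj x w ∧ ¬ G.Adj y w) ∨ (¬ Mid G v ∧ ¬ G.Adj x w ∧ ¬ G.Adj y w)) := by
    intro v x y w hxy hxw hyw hN hadj
    have hx := (hN x).2 (by simp)
    have hy := (hN y).2 (by simp)
    have hw := (hN w).2 (by simp)
    have hs := fun a b => G.adj_comm a b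
    by_cases h1 : G.Adj x w
    · have h2 : ¬ G.Adj y w := fun h2 => hK v x y w hx hy hw hadj h1 h2
      refine ⟨x, y, w, hxy, hxw, hyw, hN, hadj, Or.inl ⟨?_, h1, h2⟩⟩
      intro t ht
      rcases (hN t).1 ht with rfl | rfl | rfl
      · exact ⟨y, hy, hadj⟩
      · exact ⟨x, hx, hadj.symm⟩
      · exact ⟨x, hx, h1.symm⟩
    · by_cases h2 : G.Adj y w
      · refine ⟨y, x, w, hxy.symm, hyw, hxw, fun t => by rw [hN]; tauto, hadj.symm, Or.inl ⟨?_, h2, h1⟩⟩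
        intro t ht
        rcases (hN t).1 ht with rfl | rfl | rfl
        · exact ⟨y, hy, hadj⟩
        · exact ⟨x, hx, hadj.symm⟩
        · exact ⟨y, hy, h2.symm⟩
      · refine ⟨x, y, w, hxy, hxw, hyw, hN, hadj, Or.inr ⟨?_, h1, h2⟩⟩
        intro hM
        obtain ⟨z, hz1, hz2⟩ := hM w hw
        rcases (hN z).1 hz1 with rfl | rfl | rfl
        · exact h1 hz2.symm
        · exact h2 hz2.symm
        · exact G.irrefl hz2
  intro v
  obtain ⟨a, b, c, hab, hac, hbc, hN⟩ := hcub v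
  by_cases h1 : G.Adj a b
  · exact step v a b c hab hac hbc hN h1
  by_cases h2 : G.Adj a c
  · exact step v a c b hac hab hbc.symm (fun t => by rw [hN]; tauto) h2
  by_cases h3 : G.Adj b c
  · exact step v b c a hbc hab.symm hac.symm (fun t => by rw [hN]; tauto) h3
  exact absurd ⟨v, a, b, c, hab, hac, hbc, (hN a).2 (by simp), (hN b).2 (by simp),
    (hN c).2 (by simp), h1, h2, h3⟩ hclaw

/-- A middle vertex of a diamond. -/
theorem mid_struct (hL : Loc G) {v : V} (hv : Mid G v) : ∃ b c d, b ≠ c ∧ b ≠ d ∧ c ≠ d ∧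
    (∀ t, G.Adj v t ↔ t = b ∨ t = c ∨ t = d) ∧ (∀ t, G.Adj b t ↔ t = v ∨ t = c ∨ t = d) ∧
    Mid G b ∧ ¬ Mid G c ∧ ¬ Mid G d ∧ ¬ G.Adj c d := by
  obtain ⟨b, c, d, hbc, hbd, hcd, hN, h1, h2⟩ := hL v
  obtain ⟨-, h2, h3⟩ : Mid G v ∧ G.Adj b d ∧ ¬ G.Adj c d := by tauto
  have vb := (hN b).2 (by simp)
  have vc := (hN c).2 (by simp)
  have vd := (hN d).2 (by simp)
  have nv := vb.ne
  have nc := vc.ne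
  have nd := vd.ne
  have hb : ∀ t, G.Adj b t ↔ t = v ∨ t = c ∨ t = d := by
    obtain ⟨x, y, w, _, _, _, hM, -⟩ := hL b
    have := (hM v).1 vb.symm
    have := (hM c).1 h1
    have := (hM d).1 h2
    intro t; rw [hM]; clear hN hM; grind
  have aux : ∀ c d, G.Adj v c → G.Adj v d → G.Adj b c → G.Adj b d → c ≠ b → d ≠ b → c ≠ d → ¬ G.Adj c d → ¬ Mid G c := by
    intro c d vc vd bc bd _ _ _ ncd hc
    obtain ⟨x, y, w, _, _, _, hM, h5, h6⟩ := hL c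
    have e1 := (hM v).1 vc.symm
    have e2 := (hM b).1 bc.symm
    obtain ⟨t, ht, htv, htb⟩ : ∃ t, G.Adj c t ∧ t ≠ v ∧ t ≠ b := by
      by_contra! hh
      have := (hM x).2 (by simp)
      have := (hM y).2 (by simp)
      have := (hM w).2 (by simp)
      have := hh x; have := hh y; have := hh w
      grind
    obtain ⟨z, hz1, hz2⟩ := hc t ht
    have hz : z = v ∨ z = b := by
      have := (hM z).1 hz1
      have := (hM t).1 ht
      have := hz2.ne
      grind
    have htn := ht.ne
    have h7 : t = d := by
      rcases hz with rfl | rfl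
      · have := (hN t).1 hz2.symm
        have := (hN c).1 vc
        have := (hN d).1 vd
        grind
      · have := (hb t).1 hz2.symm
        have := (hb c).1 bc
        have := (hb d).1 bd
        grind
    subst h7; exact ncd ht
  refine ⟨b, c, d, hbc, hbd, hcd, hN, hb, ?_, aux c d vc vd h1 h2 hbc.symm hbd.symm hcd h3,
    aux d c vd vc h2 h1 hbd.symm hbc.symm hcd.symm (fun h => h3 h.symm), h3⟩
  intro t ht
  rcases (hb t).1 ht with rfl | rfl | rfl
  · exact ⟨c, h1, vc⟩
  · exact ⟨v, vb.symm, vc.symm⟩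
  · exact ⟨v, vb.symm, vd.symm⟩

/-- A vertex in a triangle unit. -/
theorem tri_struct (hL : Loc G) {v : V} (hv : Tri G v) : ∃ x y w, x ≠ y ∧ x ≠ w ∧ y ≠ w ∧
    (∀ t, G.Adj v t ↔ t = x ∨ t = y ∨ t = w) ∧ G.Adj x y ∧ ¬ G.Adj x w ∧ ¬ G.Adj y w ∧
    Tri G x ∧ Tri G y ∧ ¬ Mid G w := by
  obtain ⟨x, y, w, hxy, hxw, hyw, hN, h1, h2⟩ := hL v
  obtain ⟨-, h2, h3⟩ : ¬ Mid G v ∧ ¬ G.Adj x w ∧ ¬ G.Adj y w := by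
    have := hv.1; tauto
  have vx := (hN x).2 (by simp)
  have vy := (hN y).2 (by simp)
  have vw := (hN w).2 (by simp)
  have aux : ∀ x y, G.Adj v x → G.Adj v y → G.Adj x y → Tri G x := by
    intro x y vx vy hxy
    refine ⟨hv.2 x vx, fun t ht hm => ?_⟩
    obtain ⟨b, c, d, hbc, hbd, hcd, hM, hM', hb, hc, hd, hcd'⟩ := mid_struct hL hm
    have hx := hv.2 x vx
    have hy := hv.2 y vy
    have hxc : x = c ∨ x = d := by
      have := (hM x).1 ht.symm
      grind
    have tb := (hM b).2 (by simp)
    have xb : G.Adj b x := (hM' x).2 (by tauto)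
    have hvt : v ≠ t := fun h => hv.1 (h ▸ hm)
    have hvb : v ≠ b := fun h => hv.1 (h ▸ hb)

    obtain ⟨p, q, r, _, _, _, hX, -⟩ := hL x
    have a1 := (hX t).1 ht
    have a2 := (hX b).1 xb.symm
    have a3 := (hX v).1 vx.symm
    have a4 := (hX y).1 hxy
    have := tb.ne
    have := vy.ne
    have : y ≠ t := fun h => hy (h ▸ hm)
    have : y ≠ b := fun h => hy (h ▸ hb)
    clear hN hM hM' hX hL
    grind
  exact ⟨x, y, w, hxy, hxw, hyw, hN, h1, h2, h3, aux x y vx vy h1, aux y x vy vx h1.symm, hv.2 w vw⟩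

/-- An end vertex of a diamond. -/
theorem end_struct (hL : Loc G) {v a : V} (hv : ¬ Mid G v) (ha : Mid G a) (hva : G.Adj v a) :
    ∃ b w, a ≠ b ∧ a ≠ w ∧ b ≠ w ∧ Mid G b ∧ G.Adj a b ∧
    (∀ t, G.Adj v t ↔ t = a ∨ t = b ∨ t = w) ∧ ¬ Mid G w := by
  obtain ⟨b, c, d, hbc, hbd, hcd, hM, hM', hb, hc, hd, hcd'⟩ := mid_struct hL ha
  have hvc : v = c ∨ v = d := by
    have := (hM v).1 hva.symm
    grind
  have ab := (hM b).2 (by simp)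
  have hvb : G.Adj v b := ((hM' v).2 (by tauto)).symm
  obtain ⟨x, y, w, _, _, _, hN, -⟩ := hL v
  have e1 := (hN a).1 hva
  have e2 := (hN b).1 hvb
  have := ab.ne
  obtain ⟨w, hw⟩ : ∃ w', a ≠ w' ∧ b ≠ w' ∧ (∀ t, G.Adj v t ↔ t = a ∨ t = b ∨ t = w') := by
    simp only [hN]
    clear hN hM hM'
    by_cases hx : x ≠ a ∧ x ≠ b
    · exact ⟨x, by grind⟩
    by_cases hy : y ≠ a ∧ y ≠ b
    · exact ⟨y, by grind⟩
    · exact ⟨w, by grind⟩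
  refine ⟨b, w, ab.ne, hw.1, hw.2.1, hb, ab, hw.2.2, fun hmw => ?_⟩
  have hvw := (hw.2.2 w).2 (by simp)
  obtain ⟨z, hz1, hz2⟩ := hmw v hvw.symm
  rcases (hw.2.2 z).1 hz2 with rfl | rfl | rfl
  · have := (hM w).1 hz1.symm
    grind
  · have := (hM' w).1 hz1.symm
    grind
  · exact G.irrefl hz1

end

section
variable {V : Type*} {G : SimpleGraph V} {key d : V → ℕ} {r : V}

theorem spt_point (hkey : Function.Injective key)
    (hd1 : ∀ v, v ≠ r → ∃ w, G.Adj v w ∧ d w < d v)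
    (hd2 : ∀ v w, d v < d w → key v < key w)
    (hd3 : ∀ v, d v ≤ 1 → v = r ∨ G.Adj r v) (hd4 : ∀ v, G.Adj r v → d v ≤ 1)
    (hL : Loc G) {u v w : V} (hv : SpT G key v) (hu : SpT G key u) (huv : u ≠ v)
    (hvw : G.Adj v w) (hno : ¬ ∃ z, G.Adj v z ∧ G.Adj w z)
    (hw : w = u ∨ (G.Adj u w ∧ ∃ z, G.Adj u z ∧ G.Adj w z)) (hlt : key v < key u) : w = u := by
  have hle : key u ≤ key w := by
    rcases hw with rfl | ⟨h1, z, h2, h3⟩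
    · exact le_rfl
    · exact (hu.2 w z h1 h2 h3).le
  by_cases hr : v = r
  · subst hr
    by_contra hne
    have h1 := hd4 w hvw
    have h2 : d u ≤ 1 := by
      by_contra hh
      have := hd2 w u (by omega)
      omega
    rcases hd3 u h2 with h3 | h3
    · exact huv h3
    · rcases hw with h | ⟨h4, -⟩
      · exact hne h
      · exact hno ⟨u, h3, h4.symm⟩
  · exfalso
    obtain ⟨t, ht1, ht2⟩ := hd1 v hr
    have hk := hd2 t v ht2
    obtain ⟨x, y, w', h1, h2, h3, hN, hxy, h4, h5, hx, hy, hw'⟩ := tri_struct hL hv.1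
    have vx := (hN x).2 (by simp)
    have vy := (hN y).2 (by simp)
    have hww : w = w' := by
      rcases (hN w).1 hvw with rfl | rfl | h
      · exact absurd ⟨y, vy, hxy⟩ hno
      · exact absurd ⟨x, vx, hxy.symm⟩ hno
      · exact h
    rcases (hN t).1 ht1 with rfl | rfl | rfl
    · have := hv.2 _ _ vx vy hxy
      omega
    · have := hv.2 _ _ vy vx hxy.symm
      omega
    · subst hww; omega

theorem S_tri {v : V} (h : S G key v) (hm : ¬ Mid G v) : SpT G key v := by
  rcases h with h | h
  · exact h
  · exact absurd h.1 hm

theorem conf_tri (hkey : Function.Injective key)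
    (hd1 : ∀ v, v ≠ r → ∃ w, G.Adj v w ∧ d w < d v)
    (hd2 : ∀ v w, d v < d w → key v < key w)
    (hd3 : ∀ v, d v ≤ 1 → v = r ∨ G.Adj r v) (hd4 : ∀ v, G.Adj r v → d v ≤ 1)
    (hL : Loc G) {u : V} (hu : SpT G key u) : ∃ w, G.Adj u w ∧ (¬ ∃ z, G.Adj u z ∧ G.Adj w z) ∧
    ¬ Mid G w ∧
    ∀ v, S G key v → v ≠ u → (G.Adj u v ∨ ∃ z, G.Adj u z ∧ G.Adj z v) →
      (SpT G key v → key v < key u) → v = w ∨ G.Adj w v := by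
  obtain ⟨x, y, w, h1, h2, h3, hN, hxy, h4, h5, hx, hy, hw⟩ := tri_struct hL hu.1
  have ux := (hN x).2 (by simp)
  have uy := (hN y).2 (by simp)
  have uw := (hN w).2 (by simp)
  have kx := hu.2 _ _ ux uy hxy
  have ky := hu.2 _ _ uy ux hxy.symm
  refine ⟨w, uw, ?_, hw, ?_⟩
  · rintro ⟨z, hz1, hz2⟩
    rcases (hN z).1 hz1 with rfl | rfl | rfl
    · exact h4 hz2.symm
    · exact h5 hz2.symm
    · exact G.irrefl hz2
  have nS : ∀ x y, G.Adj u x → G.Adj u y → G.Adj x y → Tri G x → ¬ S G key x := by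
    intro x y ux uy hxy hx h
    have h' := (S_tri h hx.1).2 u y ux.symm hxy uy
    have := hu.2 x y ux uy hxy
    omega
  have aux : ∀ x y, G.Adj u x → G.Adj u y → G.Adj x y → Tri G x → Tri G y → ∀ v, S G key v → v ≠ u →
      G.Adj x v → (SpT G key v → key v < key u) → False := by
    intro x y ux uy hxy hx hy v hS hvu hxv hlt
    have hv : SpT G key v := S_tri hS (hx.2 v hxv)
    have hvy : v ≠ y := fun h => nS y x uy ux hxy.symm hy (h ▸ hS)
    have hno : ¬ ∃ z, G.Adj v z ∧ G.Adj x z := by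
      rintro ⟨z, hz1, hz2⟩
      obtain ⟨p, q, s, n1, n2, n3, hM, hpq, n4, n5, -⟩ := tri_struct hL hx
      have := (hM v).1 hxv
      have := (hM z).1 hz2
      have := (hM y).1 hxy
      have := (hM u).1 ux.symm
      have := uy.ne
      have e := fun a b => G.adj_comm a b
      have := hz1.ne
      clear hM hN
      grind
    have := spt_point hkey hd1 hd2 hd3 hd4 hL hv hu hvu.symm hxv.symm hno
      (Or.inr ⟨ux, y, uy, hxy⟩) (hlt hv)
    exact ux.ne this.symm
  intro v hS hvu hnear hlt
  rcases hnear with h | ⟨z, hz1, hz2⟩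
  · rcases (hN v).1 h with rfl | rfl | rfl
    · exact absurd hS (nS _ _ ux uy hxy hx)
    · exact absurd hS (nS _ _ uy ux hxy.symm hy)
    · exact Or.inl rfl
  · rcases (hN z).1 hz1 with rfl | rfl | rfl
    · exact (aux _ _ ux uy hxy hx hy v hS hvu hz2 hlt).elim
    · exact (aux _ _ uy ux hxy.symm hy hx v hS hvu hz2 hlt).elim
    · exact Or.inr hz2

theorem conf_uniq (hL : Loc G) {u w : V} (hu : SpT G key u)
    (huw : G.Adj u w) (hno : ¬ ∃ z, G.Adj u z ∧ G.Adj w z) (hw : ¬ Mid G w)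
    {v₁ v₂ : V} (hv₁ : S G key v₁) (hv₂ : S G key v₂) (n₁ : v₁ ≠ u) (n₂ : v₂ ≠ u)
    (h₁ : v₁ = w ∨ G.Adj w v₁) (h₂ : v₂ = w ∨ G.Adj w v₂) : v₁ = v₂ := by
  by_contra hne
  by_cases hT : Tri G w
  · obtain ⟨x, y, t, h1, h2, h3, hN, hxy, h4, h5, hx, hy, ht⟩ := tri_struct hL hT
    have wx := (hN x).2 (by simp)
    have wy := (hN y).2 (by simp)
    have hut : u = t := by
      rcases (hN u).1 huw.symm with rfl | rfl | h
      · exact absurd ⟨y, hxy, wy⟩ hno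
      · exact absurd ⟨x, hxy.symm, wx⟩ hno
      · exact h
    rw [hN] at h₁ h₂
    have m₁ : v₁ = w ∨ v₁ = x ∨ v₁ = y := by grind
    have m₂ : v₂ = w ∨ v₂ = x ∨ v₂ = y := by grind
    have s : ∀ v, (v = w ∨ v = x ∨ v = y) → S G key v → SpT G key v := by
      intro v hv hS
      refine S_tri hS ?_
      rcases hv with rfl | rfl | rfl
      · exact hT.1
      · exact hx.1
      · exact hy.1
    have q₁ := (s _ m₁ hv₁).2
    have q₂ := (s _ m₂ hv₂).2
    have a1 := q₁ v₂
    have a2 := q₂ v₁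
    have tri : ∀ a b c, G.Adj a b → G.Adj a c → G.Adj b c → (a = v₁ ∧ b = v₂) → False := by
      rintro a b c h1 h2 h3 ⟨rfl, rfl⟩
      have := q₁ b c h1 h2 h3
      have := q₂ a c h1.symm h3 h2
      omega
    have := wx.symm
    have := wy.symm
    have := hxy.symm
    rcases m₁ with rfl | rfl | rfl <;> rcases m₂ with rfl | rfl | rfl <;> try exact hne rfl
    · exact tri _ _ y wx wy hxy ⟨rfl, rfl⟩
    · exact tri _ _ x wy wx hxy.symm ⟨rfl, rfl⟩
    · exact tri _ _ y wx.symm hxy wy ⟨rfl, rfl⟩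
    · exact tri _ _ w hxy wx.symm wy.symm ⟨rfl, rfl⟩
    · exact tri _ _ x wy.symm hxy.symm wx ⟨rfl, rfl⟩
    · exact tri _ _ w hxy.symm wy.symm wx.symm ⟨rfl, rfl⟩
  · have : ∃ a, G.Adj w a ∧ Mid G a := by
      by_contra! h
      exact hT ⟨hw, h⟩
    obtain ⟨a, wa, ha⟩ := this
    obtain ⟨b, t, hab, hat, hbt, hb, hadj, hN, ht⟩ := end_struct hL hw ha wa
    have wb := (hN b).2 (by simp)
    have hut : u = t := by
      rcases (hN u).1 huw.symm with rfl | rfl | h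
      · exact absurd ha hu.1.1
      · exact absurd hb hu.1.1
      · exact h
    have hwS : ¬ S G key w := fun h => hT (S_tri h hw).1
    rw [hN] at h₁ h₂
    have m₁ : v₁ = a ∨ v₁ = b := by
      rcases h₁ with rfl | h₁
      · exact absurd hv₁ hwS
      · grind
    have m₂ : v₂ = a ∨ v₂ = b := by
      rcases h₂ with rfl | h₂
      · exact absurd hv₂ hwS
      · grind
    have fst : ∀ v v', Mid G v → Mid G v' → G.Adj w v → S G key v → G.Adj v v' → key v < key v' := by
      intro v v' hv hv' hwv hS hvv
      rcases hS with h | ⟨-, h | h⟩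
      · exact absurd hv h.1.1
      · exact h v' hv' hvv
      · exact absurd ⟨w, u, hwv.symm, huw.symm, hu⟩ h
    have f1 := fst a b ha hb wa
    have f2 := fst b a hb ha wb
    rcases m₁ with rfl | rfl <;> rcases m₂ with rfl | rfl <;> try exact hne rfl
    · have := f1 hv₁ hadj
      have := f2 hv₂ hadj.symm
      omega
    · have := f1 hv₂ hadj
      have := f2 hv₁ hadj.symm
      omega

/-- two mids at distance at most two are twins -/
theorem mid_near (hL : Loc G) {u : V} (hu : Mid G u) : ∃ b, ∀ v, Mid G v → v ≠ u →
    (G.Adj u v ∨ ∃ z, G.Adj u z ∧ G.Adj z v) → v = b := by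
  obtain ⟨b, c, d, hbc, hbd, hcd, hM, hM', hb, hc, hd, hcd'⟩ := mid_struct hL hu
  have ub := (hM b).2 (by simp)
  refine ⟨b, fun v hv hvu hn => ?_⟩
  rcases hn with h | ⟨z, h1, h2⟩
  · have := (hM v).1 h; grind
  · have endc : ∀ c, ¬ Mid G c → G.Adj u c → G.Adj c v → v = b := by
      intro c hc huc hcv
      obtain ⟨b', t, hab, hat, hbt, hb', hadj, hN, ht⟩ := end_struct hL hc hu huc.symm
      have e1 := (hM b').1 hadj
      have := (hN v).1 hcv
      grind
    rcases (hM z).1 h1 with rfl | rfl | rfl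
    · have := (hM' v).1 h2; grind
    · exact endc _ hc h1 h2
    · exact endc _ hd h1 h2

theorem color_S (hkey : Function.Injective key) (K : ℕ) (hK : ∀ v, key v < K)
    (hd1 : ∀ v, v ≠ r → ∃ w, G.Adj v w ∧ d w < d v)
    (hd2 : ∀ v w, d v < d w → key v < key w)
    (hd3 : ∀ v, d v ≤ 1 → v = r ∨ G.Adj r v) (hd4 : ∀ v, G.Adj r v → d v ≤ 1)
    (hL : Loc G) : ∃ c : V → Prop, ∀ u v, (S G key u ∧ S G key v ∧ u ≠ v ∧
      (G.Adj u v ∨ ∃ z, G.Adj u z ∧ G.Adj z v)) → (c v ↔ ¬ c u) := by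
  classical
  refine forest_color (fun u v => S G key u ∧ S G key v ∧ u ≠ v ∧
      (G.Adj u v ∨ ∃ z, G.Adj u z ∧ G.Adj z v))
    (fun v => if Mid G v then key v else K + key v) ?_ ?_ ?_
  · rintro u v ⟨h1, h2, h3, h4⟩
    refine ⟨h2, h1, h3.symm, ?_⟩
    rcases h4 with h | ⟨z, h, h'⟩
    · exact Or.inl h.symm
    · exact Or.inr ⟨z, h'.symm, h.symm⟩
  · rintro u v ⟨h1, h2, h3, h4⟩
    have := hK u
    have := hK v
    have : key u ≠ key v := fun h => h3 (hkey h)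
    split_ifs <;> omega
  · rintro u v w ⟨h1, h2, h3, h4⟩ ⟨-, h2', h3', h4'⟩ hv hw

    have k1 := hK u
    by_cases hm : Mid G u
    · have mv : Mid G v := by
        by_contra hh
        simp only [hm, hh, if_true, if_false] at hv
        omega
      have mw : Mid G w := by
        by_contra hh
        simp only [hm, hh, if_true, if_false] at hw
        omega
      obtain ⟨b, hb⟩ := mid_near hL hm
      rw [hb v mv h3.symm h4, hb w mw h3'.symm h4']
    · obtain ⟨t, ht1, ht2, ht3, ht4⟩ := conf_tri hkey hd1 hd2 hd3 hd4 hL (S_tri h1 hm)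
      refine conf_uniq hL (S_tri h1 hm) ht1 ht2 ht3 h2 h2' h3.symm h3'.symm
        (ht4 v h2 h3.symm h4 ?_) (ht4 w h2' h3'.symm h4' ?_)
      · intro h
        simp only [hm, h.1.1, if_false] at hv
        omega
      · intro h
        simp only [hm, h.1.1, if_false] at hw
        omega

end

section
variable {V : Type*} {G : SimpleGraph V} {key : V → ℕ}

def PS (G : SimpleGraph V) (key : V → ℕ) (c : V) : Prop := ∃ u, G.Adj c u ∧ SpT G key u
def Ch (G : SimpleGraph V) (key : V → ℕ) (b c : V) : Prop :=
  Mid G b ∧ ¬ Mid G c ∧ G.Adj b c ∧ PS G key c ∧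
    ∀ e, ¬ Mid G e → G.Adj b e → PS G key e → key c ≤ key e
def RR (G : SimpleGraph V) (key : V → ℕ) (u v : V) : Prop :=
  G.Adj u v ∧ ¬ S G key u ∧ ¬ S G key v
def MM (G : SimpleGraph V) (key : V → ℕ) (u v : V) : Prop :=
  (¬ ∃ z, G.Adj u z ∧ G.Adj v z) ∨ Ch G key u v ∨ Ch G key v u

theorem nonS_mid (hkey : Function.Injective key) (hL : Loc G) {b : V} (hb : Mid G b)
    (hS : ¬ S G key b) : ∃ a c d, S G key a ∧ Mid G a ∧ ¬ Mid G c ∧ ¬ Mid G d ∧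
    (∀ t, G.Adj b t ↔ t = a ∨ t = c ∨ t = d) ∧ Ch G key b c := by
  obtain ⟨a, c, d, hac, had, hcd, hM, hM', ha, hc, hd, hcd'⟩ := mid_struct hL hb
  have ba := (hM a).2 (by simp)
  have bc := (hM c).2 (by simp)
  have bd := (hM d).2 (by simp)
  have ac := (hM' c).2 (by simp)
  have ad := (hM' d).2 (by simp)
  have hP : Ptd G key b := by
    by_contra h; exact hS (Or.inr ⟨hb, Or.inr h⟩)
  have hlt : key a < key b := by
    by_contra h
    apply hS
    refine Or.inr ⟨hb, Or.inl fun t ht hbt => ?_⟩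
    have : t = a := by
      rcases (hM t).1 hbt with rfl | rfl | rfl
      · rfl
      · exact absurd ht hc
      · exact absurd ht hd
    subst this
    have : key b ≠ key t := fun h => ba.ne (hkey h)
    omega
  have hSa : S G key a := by
    refine Or.inr ⟨ha, Or.inl fun t ht hat => ?_⟩
    rcases (hM' t).1 hat with rfl | rfl | rfl
    · exact hlt
    · exact absurd ht hc
    · exact absurd ht hd
  have hPS : PS G key c ∨ PS G key d := by
    obtain ⟨c', u, h1, h2, h3⟩ := hP
    rcases (hM c').1 h1 with rfl | rfl | rfl
    · exact absurd ha (h3.1.2 _ h2.symm)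
    · exact Or.inl ⟨u, h2, h3⟩
    · exact Or.inr ⟨u, h2, h3⟩
  by_cases hcase : PS G key c ∧ (PS G key d → key c ≤ key d)
  · refine ⟨a, c, d, hSa, ha, hc, hd, hM, hb, hc, bc, hcase.1, ?_⟩
    intro e he hbe hpe
    rcases (hM e).1 hbe with rfl | rfl | rfl
    · exact absurd ha he
    · exact le_rfl
    · exact hcase.2 hpe
  · have hpd : PS G key d := by tauto
    have hle : PS G key c → key d ≤ key c := by
      intro h
      by_contra h'
      exact hcase ⟨h, fun _ => by omega⟩
    refine ⟨a, d, c, hSa, ha, hd, hc, fun t => by rw [hM]; tauto, hb, hd, bd, hpd, ?_⟩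
    intro e he hbe hpe
    rcases (hM e).1 hbe with rfl | rfl | rfl
    · exact absurd ha he
    · exact hle hpe
    · exact le_rfl

theorem nonS_twin (hkey : Function.Injective key) (hL : Loc G) {a b : V} (ha : Mid G a)
    (hb : Mid G b) (hab : G.Adj a b) (h1 : ¬ S G key a) (h2 : ¬ S G key b) : False := by
  obtain ⟨a', c, d, hSa, ha', hc, hd, hM, -⟩ := nonS_mid hkey hL hb h2
  rcases (hM a).1 hab.symm with rfl | rfl | rfl
  · exact h1 hSa
  · exact hc ha
  · exact hd ha

theorem tri_adj2 (hL : Loc G) {u x y : V} (hu : Tri G u) (ux : G.Adj u x) (uy : G.Adj u y)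
    (xy : G.Adj x y) : ∀ p q, G.Adj u p → G.Adj u q → G.Adj p q → p = x ∨ p = y := by
  obtain ⟨x', y', w, h1, h2, h3, hN, hxy, h4, h5, -⟩ := tri_struct hL hu
  intro p q up uq pq
  have a1 := (hN x).1 ux
  have a2 := (hN y).1 uy
  have a3 := (hN p).1 up
  have a4 := (hN q).1 uq
  have := pq.ne
  have := xy.ne
  have := pq.symm
  have := xy.symm
  clear hN
  grind

theorem tri_S (hkey : Function.Injective key) (hL : Loc G) {u x y : V} (hu : Tri G u)
    (hx : Tri G x) (hy : Tri G y) (ux : G.Adj u x) (uy : G.Adj u y)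
    (xy : G.Adj x y) (nu : ¬ S G key u) (nx : ¬ S G key x) (ny : ¬ S G key y) : False := by
  have aux : ∀ u x y, Tri G u → G.Adj u x → G.Adj u y → G.Adj x y → key u < key x → key u < key y →
      S G key u := by
    intro u x y hu ux uy xy k1 k2
    refine Or.inl ⟨hu, fun p q up uq pq => ?_⟩
    rcases tri_adj2 hL hu ux uy xy p q up uq pq with rfl | rfl <;> assumption
  have n1 : key u ≠ key x := fun h => ux.ne (hkey h)
  have n2 : key u ≠ key y := fun h => uy.ne (hkey h)
  have n3 : key x ≠ key y := fun h => xy.ne (hkey h)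
  have a1 := mt (aux u x y hu ux uy xy)
  have a2 := mt (aux x u y hx ux.symm xy uy)
  have a3 := mt (aux y u x hy uy.symm xy.symm ux)
  rcases lt_or_gt_of_ne n1 with h1 | h1 <;> rcases lt_or_gt_of_ne n2 with h2 | h2 <;>
    rcases lt_or_gt_of_ne n3 with h3 | h3 <;>
    first
      | exact nu (aux u x y hu ux uy xy (by omega) (by omega))
      | exact nx (aux x u y hx ux.symm xy uy (by omega) (by omega))
      | exact ny (aux y u x hy uy.symm xy.symm ux (by omega) (by omega))

theorem MM_fun (hkey : Function.Injective key) (hL : Loc G) (u v w : V)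
    (hv : RR G key u v ∧ MM G key u v) (hw : RR G key u w ∧ MM G key u w) : v = w := by
  obtain ⟨⟨uv, nu, nv⟩, hv⟩ := hv
  obtain ⟨⟨uw, -, nw⟩, hw⟩ := hw
  by_cases hm : Mid G u
  · have h1 : ∀ v, G.Adj u v → MM G key u v → Ch G key u v := by
      rintro v h (h1 | h1 | h1)
      · exact absurd (hm v h) h1
      · exact h1
      · exact absurd hm h1.2.1
    have c1 := h1 v uv hv
    have c2 := h1 w uw hw
    apply hkey
    have := c1.2.2.2.2 w c2.2.1 uw c2.2.2.2.1
    have := c2.2.2.2.2 v c1.2.1 uv c1.2.2.2.1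
    omega
  · by_cases hT : Tri G u
    · obtain ⟨x, y, t, h1, h2, h3, hN, hxy, h4, h5, hx, hy, ht⟩ := tri_struct hL hT
      have ux := (hN x).2 (by simp)
      have uy := (hN y).2 (by simp)
      have e : ∀ v, G.Adj u v → MM G key u v → v = t := by
        rintro v h (g1 | g1 | g1)
        · rcases (hN v).1 h with rfl | rfl | h'
          · exact absurd ⟨y, uy, hxy⟩ g1
          · exact absurd ⟨x, ux, hxy.symm⟩ g1
          · exact h'
        · exact absurd g1.1 hm
        · exact absurd g1.1 (hT.2 v h)
      rw [e v uv hv, e w uw hw]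
    · have : ∃ a, G.Adj u a ∧ Mid G a := by
        by_contra! h
        exact hT ⟨hm, h⟩
      obtain ⟨a, ua, ha⟩ := this
      obtain ⟨b, t, hab, hat, hbt, hb, hadj, hN, ht⟩ := end_struct hL hm ha ua
      have ub := (hN b).2 (by simp)
      have e : ∀ v, G.Adj u v → MM G key u v → (v = t) ∨ (Mid G v ∧ (v = a ∨ v = b) ∧ S G key t) := by
        rintro v h (h1 | h1 | h1)
        · rcases (hN v).1 h with rfl | rfl | h'
          · exact absurd ⟨b, ub, hadj⟩ h1
          · exact absurd ⟨a, ua, hadj.symm⟩ h1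
          · exact Or.inl h'
        · exact absurd h1.1 hm
        · refine Or.inr ⟨h1.1, ?_, ?_⟩
          · rcases (hN v).1 h with h' | h' | h'
            · exact Or.inl h'
            · exact Or.inr h'
            · subst h'; exact absurd h1.1 ht
          · obtain ⟨s, hs1, hs2⟩ := h1.2.2.2.1
            rcases (hN s).1 hs1 with rfl | rfl | rfl
            · exact absurd ha hs2.1.1
            · exact absurd hb hs2.1.1
            · exact Or.inl hs2
      rcases e v uv hv with rfl | ⟨p1, p2, p3⟩ <;> rcases e w uw hw with rfl | ⟨q1, q2, q3⟩
      · rfl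
      · exact absurd q3 nv
      · exact absurd p3 nw
      · rcases p2 with rfl | rfl <;> rcases q2 with rfl | rfl
        · rfl
        · exact (nonS_twin hkey hL ha hb hadj nv nw).elim
        · exact (nonS_twin hkey hL ha hb hadj nw nv).elim
        · rfl

theorem notMM_fun (hkey : Function.Injective key) (hL : Loc G) (u v w : V)
    (hv : RR G key u v ∧ ¬ MM G key u v) (hw : RR G key u w ∧ ¬ MM G key u w) : v = w := by
  obtain ⟨⟨uv, nu, nv⟩, hv⟩ := hv
  obtain ⟨⟨uw, -, nw⟩, hw⟩ := hw
  by_cases hm : Mid G u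
  · obtain ⟨a, c, d, hSa, ha, hc, hd, hM, hch⟩ := nonS_mid hkey hL hm nu
    have e : ∀ v, G.Adj u v → ¬ S G key v → ¬ MM G key u v → v = d := by
      intro v h h1 h2
      rcases (hM v).1 h with rfl | rfl | h'
      · exact absurd hSa h1
      · exact absurd (Or.inr (Or.inl hch)) h2
      · exact h'
    rw [e v uv nv hv, e w uw nw hw]
  · by_cases hT : Tri G u
    · obtain ⟨x, y, t, h1, h2, h3, hN, hxy, h4, h5, hx, hy, ht⟩ := tri_struct hL hT
      have ux := (hN x).2 (by simp)
      have uy := (hN y).2 (by simp)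
      have e : ∀ v, G.Adj u v → ¬ MM G key u v → v = x ∨ v = y := by
        intro v h h1
        rcases (hN v).1 h with h' | h' | h'
        · exact Or.inl h'
        · exact Or.inr h'
        · subst h'
          exfalso; apply h1; left
          rintro ⟨z, hz1, hz2⟩
          rcases (hN z).1 hz1 with rfl | rfl | rfl
          · exact h4 hz2.symm
          · exact h5 hz2.symm
          · exact G.irrefl hz2
      rcases e v uv hv with rfl | rfl <;> rcases e w uw hw with rfl | rfl
      · rfl
      · exact (tri_S hkey hL hT hx hy ux uy hxy nu nv nw).elim
      · exact (tri_S hkey hL hT hx hy ux uy hxy nu nw nv).elim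
      · rfl
    · have : ∃ a, G.Adj u a ∧ Mid G a := by
        by_contra! h
        exact hT ⟨hm, h⟩
      obtain ⟨a, ua, ha⟩ := this
      obtain ⟨b, t, hab, hat, hbt, hb, hadj, hN, ht⟩ := end_struct hL hm ha ua
      have ub := (hN b).2 (by simp)
      have ut := (hN t).2 (by simp)
      have e : ∀ v, G.Adj u v → ¬ MM G key u v → v = a ∨ v = b := by
        intro v h h1
        rcases (hN v).1 h with h' | h' | h'
        · exact Or.inl h'
        · exact Or.inr h'
        · subst h'
          exfalso; apply h1; left
          intro hz
          apply hm
          intro s hs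
          rcases (hN s).1 hs with rfl | rfl | rfl
          · exact ⟨b, ub, hadj⟩
          · exact ⟨a, ua, hadj.symm⟩
          · exact hz
      rcases e v uv hv with rfl | rfl <;> rcases e w uw hw with rfl | rfl
      · rfl
      · exact (nonS_twin hkey hL ha hb hadj nv nw).elim
      · exact (nonS_twin hkey hL ha hb hadj nw nv).elim
      · rfl

theorem MM_symm {u v : V} (h : MM G key u v) : MM G key v u := by
  rcases h with h | h | h
  · left
    rintro ⟨z, h1, h2⟩
    exact h ⟨z, h2, h1⟩
  · exact Or.inr (Or.inr h)
  · exact Or.inr (Or.inl h)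

theorem RR_symm {u v : V} (h : RR G key u v) : RR G key v u := ⟨h.1.symm, h.2.2, h.2.1⟩

theorem color_R (hkey : Function.Injective key) (hL : Loc G) :
    ∃ f : V → Prop, ∀ u v, RR G key u v → (f v ↔ ¬ f u) := by
  obtain ⟨f, hf⟩ := two_matchings (fun u v => RR G key u v ∧ MM G key u v)
    (fun u v => RR G key u v ∧ ¬ MM G key u v)
    (fun u v h => ⟨RR_symm h.1, MM_symm h.2⟩) (fun u h => G.irrefl h.1.1) (MM_fun hkey hL)
    (fun u v h => ⟨RR_symm h.1, fun h' => h.2 (MM_symm h')⟩) (fun u h => G.irrefl h.1.1)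
    (notMM_fun hkey hL)
  refine ⟨f, fun u v h => hf u v ?_⟩
  by_cases h' : MM G key u v
  · exact Or.inl ⟨h, h'⟩
  · exact Or.inr ⟨h, h'⟩

theorem near_of_edist {u v : V} (hne : u ≠ v) (h : ¬ 2 < G.edist u v) :
    G.Adj u v ∨ ∃ z, G.Adj u z ∧ G.Adj z v := by
  rw [not_lt] at h
  have hr : G.edist u v ≠ ⊤ := by
    intro h'; rw [h'] at h; exact absurd h (by simp)
  obtain ⟨p, hp⟩ := SimpleGraph.exists_walk_of_edist_ne_top hr
  rw [← hp] at h
  have h2 : p.length ≤ 2 := by exact_mod_cast h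
  cases p with
  | nil => exact absurd rfl hne
  | cons h1 p =>
    cases p with
    | nil => exact Or.inl h1
    | cons h3 p =>
      cases p with
      | nil => exact Or.inr ⟨_, h1, h3⟩
      | cons h4 p => simp at h2

theorem coloring_of (P : V → Prop) (c f : V → Prop)
    (hc : ∀ u v, (P u ∧ P v ∧ u ≠ v ∧
      (G.Adj u v ∨ ∃ z, G.Adj u z ∧ G.Adj z v)) → (c v ↔ ¬ c u))
    (hf : ∀ u v, (G.Adj u v ∧ ¬ P u ∧ ¬ P v) → (f v ↔ ¬ f u)) :
    ∃ g : V → Fin 4, IsColoring1122 G g := by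
  classical
  refine ⟨fun v => if P v then (if c v then 2 else 3) else (if f v then 0 else 1), ?_, ?_, ?_, ?_⟩
  · intro u v hu hv h
    have := hf u v
    dsimp only at hu hv
    split_ifs at hu hv <;> simp_all
  · intro u v hu hv h
    have := hf u v
    dsimp only at hu hv
    split_ifs at hu hv <;> simp_all
  · intro u v hne hu hv
    by_contra h
    have h' := near_of_edist hne h
    have h2 := fun a b => hc u v ⟨a, b, hne, h'⟩
    dsimp only at hu hv
    split_ifs at hu hv <;> first | exact absurd hu (by decide) | exact absurd hv (by decide) | (have h3 := h2 (by assumption) (by assumption); clear h2 h' hc hf; tauto)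
  · intro u v hne hu hv
    by_contra h
    have h' := near_of_edist hne h
    have h2 := fun a b => hc u v ⟨a, b, hne, h'⟩
    dsimp only at hu hv
    split_ifs at hu hv <;> first | exact absurd hu (by decide) | exact absurd hv (by decide) | (have h3 := h2 (by assumption) (by assumption); clear h2 h' hc hf; tauto)

theorem coloring_K4 {a b c d : V} (hconn : G.Connected)
    (hcub : ∀ v, ∃ a b c, a ≠ b ∧ a ≠ c ∧ b ≠ c ∧ ∀ t, G.Adj v t ↔ t = a ∨ t = b ∨ t = c)
    (ab : G.Adj a b) (ac : G.Adj a c) (ad : G.Adj a d) (bc : G.Adj b c) (bd : G.Adj b d)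
    (cd : G.Adj c d) : ∃ g : V → Fin 4, IsColoring1122 G g := by
  classical
  have closed : ∀ v x y z, G.Adj v x → G.Adj v y → G.Adj v z → x ≠ y → x ≠ z → y ≠ z →
      ∀ t, G.Adj v t → t = x ∨ t = y ∨ t = z := by
    intro v x y z vx vy vz h1 h2 h3 t vt
    obtain ⟨p, q, s, n1, n2, n3, hN⟩ := hcub v
    rw [hN] at vx vy vz vt
    clear hN
    grind
  have ca := closed a b c d ab ac ad bc.ne bd.ne cd.ne
  have cb := closed b a c d ab.symm bc bd ac.ne ad.ne cd.ne
  have cc := closed c a b d ac.symm bc.symm cd ab.ne ad.ne bd.ne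
  have cd' := closed d a b c ad.symm bd.symm cd.symm ab.ne ac.ne bc.ne
  have step : ∀ u v, G.Walk u v → (u = a ∨ u = b ∨ u = c ∨ u = d) →
      (v = a ∨ v = b ∨ v = c ∨ v = d) := by
    intro u v p
    induction p with
    | nil => exact id
    | cons h p ih =>
      intro hu
      apply ih
      rcases hu with rfl | rfl | rfl | rfl
      · have := ca _ h; tauto
      · have := cb _ h; tauto
      · have := cc _ h; tauto
      · have := cd' _ h; tauto
  have all : ∀ v, v = a ∨ v = b ∨ v = c ∨ v = d := by
    intro v
    obtain ⟨p⟩ := hconn.preconnected a v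
    exact step a v p (Or.inl rfl)
  refine coloring_of (G := G) (fun v => v = a ∨ v = b) (fun v => v = a) (fun v => v = c) ?_ ?_
  · rintro u v ⟨h1, h2, h3, -⟩
    have := ab.ne
    grind
  · rintro u v ⟨h1, h2, h3⟩
    have := all u
    have := all v
    have := cd.ne
    have := h1.ne
    grind

end
end PC

/-- Every `2`-edge-connected (connected and bridgeless), claw-free cubic graph admits a
`(1,1,2,2)`-packing coloring. -/
theorem two_edge_connected_clawfree_cubic_is_1122_colorable {V : Type*} [Fintype V] [DecidableEq V]
    (G : SimpleGraph V) [DecidableRel G.Adj]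
    (hconn : G.Connected) (hbridgeless : ∀ e : Sym2 V, ¬ G.IsBridge e)
    (hcubic : ∀ v : V, G.degree v = 3) (hclawfree : IsClawFree G) :
    ∃ f : V → Fin 4, IsColoring1122 G f := by
  have hcub : ∀ v, ∃ a b c, a ≠ b ∧ a ≠ c ∧ b ≠ c ∧ ∀ t, G.Adj v t ↔ t = a ∨ t = b ∨ t = c := by
    intro v
    obtain ⟨a, b, c, h1, h2, h3, h4⟩ := Finset.card_eq_three.1 (hcubic v)
    refine ⟨a, b, c, h1, h2, h3, fun t => ?_⟩
    rw [← SimpleGraph.mem_neighborFinset, h4]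
    simp
  by_cases hK : ∀ a b c d, G.Adj a b → G.Adj a c → G.Adj a d → G.Adj b c → G.Adj b d →
      G.Adj c d → False
  · have hL := PC.loc_of hcub hclawfree hK
    obtain ⟨r⟩ := hconn.nonempty
    let e := Fintype.equivFin V
    let n := Fintype.card V
    let d : V → ℕ := fun v => G.dist r v
    let key : V → ℕ := fun v => d v * n + (e v : ℕ)
    have he : ∀ v, (e v : ℕ) < n := fun v => (e v).2
    have hd2 : ∀ v w, d v < d w → key v < key w := by
      intro v w h
      have h1 : (d v + 1) * n ≤ d w * n := Nat.mul_le_mul_right n h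
      have := he v
      simp only [key]
      rw [Nat.add_mul] at h1
      omega
    have hkey : Function.Injective key := by
      intro v w h
      have hdd : d v = d w := by
        rcases lt_trichotomy (d v) (d w) with h1 | h1 | h1
        · have := hd2 v w h1; omega
        · exact h1
        · have := hd2 w v h1; omega
      simp only [key, hdd] at h
      exact e.injective (Fin.ext (by omega))
    have hd1 : ∀ v, v ≠ r → ∃ w, G.Adj v w ∧ d w < d v := by
      intro v hv
      obtain ⟨p, hp⟩ := hconn.exists_walk_length_eq_dist v r
      cases p with
      | nil => exact absurd rfl hv
      | @cons _ w _ h p =>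
        refine ⟨w, h, ?_⟩
        have h1 := SimpleGraph.dist_le p
        simp only [SimpleGraph.Walk.length_cons] at hp
        simp only [d]
        rw [SimpleGraph.dist_comm (u := r) (v := w), SimpleGraph.dist_comm (u := r) (v := v)]
        omega
    have hd3 : ∀ v, d v ≤ 1 → v = r ∨ G.Adj r v := by
      intro v hv
      rcases Nat.le_one_iff_eq_zero_or_eq_one.1 hv with h | h
      · exact Or.inl ((hconn.dist_eq_zero_iff).1 h).symm
      · exact Or.inr (SimpleGraph.dist_eq_one_iff_adj.1 h)
    have hd4 : ∀ v, G.Adj r v → d v ≤ 1 := fun v h => (SimpleGraph.dist_eq_one_iff_adj.2 h).le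
    have hbd : ∀ v, key v < Finset.univ.sup key + 1 := fun v =>
      Nat.lt_succ_of_le (Finset.le_sup (Finset.mem_univ v))
    obtain ⟨c, hc⟩ := PC.color_S hkey _ hbd hd1 hd2 hd3 hd4 hL
    obtain ⟨f, hf⟩ := PC.color_R hkey hL
    exact PC.coloring_of _ c f hc hf
  · push Not at hK
    obtain ⟨a, b, c, d, ab, ac, ad, bc, bd, cd, -⟩ := hK
    exact PC.coloring_K4 hconn hcub ab ac ad bc bd cd
end

section
/- Every bridgeless cubic multigraph contains a 2-factor, i.e., a spanning subgraph in which every vertex has degree exactly 2. -/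
/-- A loopless multigraph: a set of edges `E`, each with two distinct endpoints in `V`. -/
structure Multigraph (V : Type*) (E : Type*) where
  ends : E → Sym2 V
  loopless : ∀ e : E, ¬ (ends e).IsDiag

namespace Multigraph

variable {V E : Type*}

/-- `u` and `v` are joined by a walk using only edges from `S`. -/
def Connects (M : Multigraph V E) (S : Set E) (u v : V) : Prop :=
  Relation.ReflTransGen (fun a b => ∃ e ∈ S, M.ends e = s(a, b)) u v

/-- The multigraph is connected using only the edges in `S`. -/
def ConnectedOn (M : Multigraph V E) (S : Set E) : Prop :=
  ∀ u v : V, M.Connects S u v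

/-- The multigraph is connected. -/
def Connected (M : Multigraph V E) : Prop := M.ConnectedOn Set.univ

/-- An edge is a bridge if its deletion disconnects its endpoints. -/
def IsBridge (M : Multigraph V E) (e : E) : Prop :=
  ∀ u v : V, M.ends e = s(u, v) → ¬ M.Connects {e' | e' ≠ e} u v

/-- The degree of a vertex: the number of edges incident with it. -/
noncomputable def degree (M : Multigraph V E) (v : V) : ℕ :=
  {e : E | v ∈ M.ends e}.ncard

/-- The multigraph is cubic: every vertex has degree `3`. -/
def IsCubic (M : Multigraph V E) : Prop := ∀ v : V, M.degree v = 3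

/-- A `2`-factor: a set of edges in which every vertex lies on exactly two edges,
i.e. a spanning `2`-regular subgraph. -/
def IsTwoFactor (M : Multigraph V E) (F : Set E) : Prop :=
  ∀ v : V, {e : E | e ∈ F ∧ v ∈ M.ends e}.ncard = 2

end Multigraph

namespace Multigraph

open Classical in
/-- Edges leaving the vertex set `S`. -/
noncomputable def bdry {V E : Type*} [Fintype V] [Fintype E] (M : Multigraph V E)
    (S : Finset V) : Finset E :=
  Finset.univ.filter (fun e => ∃ a ∈ S, ∃ b, b ∉ S ∧ M.ends e = s(a, b))

open Classical in
/-- Edges at a vertex. -/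
noncomputable def inc {V E : Type*} [Fintype E] (M : Multigraph V E) (v : V) : Finset E :=
  Finset.univ.filter (fun e => v ∈ M.ends e)

lemma card_inc {V E : Type*} [Fintype E] (M : Multigraph V E) (hc : M.IsCubic) (v : V) :
    (M.inc v).card = 3 := by
  classical
  rw [← hc v, degree, ← Set.ncard_coe_finset]
  congr 1
  ext e
  simp [inc]

open Classical in
lemma count_mod {V E : Type*} [Fintype V] [Fintype E] (M : Multigraph V E)
    (S : Finset V) (e : E) :
    (S.filter (fun v => v ∈ M.ends e)).card % 2 = if e ∈ M.bdry S then 1 else 0 := by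
  have hl := M.loopless e
  generalize hx : M.ends e = x at hl
  induction x using Sym2.ind with
  | _ a b =>
  have hab : a ≠ b := by simpa using hl
  have hm : e ∈ M.bdry S ↔ (a ∈ S ∧ b ∉ S) ∨ (b ∈ S ∧ a ∉ S) := by
    simp only [bdry, Finset.mem_filter, Finset.mem_univ, true_and, hx, Sym2.eq_iff]
    constructor
    · rintro ⟨c, hc, d, hd, ⟨rfl, rfl⟩ | ⟨rfl, rfl⟩⟩
      · exact Or.inl ⟨hc, hd⟩
      · exact Or.inr ⟨hc, hd⟩
    · rintro (⟨h1, h2⟩ | ⟨h1, h2⟩)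
      · exact ⟨a, h1, b, h2, Or.inl ⟨rfl, rfl⟩⟩
      · exact ⟨b, h1, a, h2, Or.inr ⟨rfl, rfl⟩⟩
  have hf : S.filter (fun v => v ∈ s(a, b)) =
      (if a ∈ S then {a} else ∅) ∪ (if b ∈ S then {b} else ∅) := by
    ext v
    simp only [Finset.mem_filter, Sym2.mem_iff, Finset.mem_union]
    by_cases ha : a ∈ S <;> by_cases hb : b ∈ S <;> simp [ha, hb] <;> grind
  rw [hf]
  by_cases ha : a ∈ S <;> by_cases hb : b ∈ S <;> simp [ha, hb, hm, hab]

lemma bdry_parity {V E : Type*} [Fintype V] [Fintype E] (M : Multigraph V E)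
    (hc : M.IsCubic) (S : Finset V) : (M.bdry S).card % 2 = S.card % 2 := by
  classical
  have h1 : ∑ e : E, (S.filter (fun v => v ∈ M.ends e)).card = 3 * S.card := by
    have := Finset.sum_card_bipartiteAbove_eq_sum_card_bipartiteBelow
      (s := (Finset.univ : Finset E)) (t := S) (fun e v => v ∈ M.ends e)
    simp only [Finset.bipartiteAbove, Finset.bipartiteBelow] at this
    rw [this]
    have h3 : ∀ v ∈ S, (Finset.univ.filter (fun e => v ∈ M.ends e)).card = 3 := fun v _ => by
      rw [← M.card_inc hc v]; congr 1
    rw [Finset.sum_congr rfl h3]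
    simp [mul_comm]
  have h2 : (∑ e : E, (S.filter (fun v => v ∈ M.ends e)).card) % 2 = (M.bdry S).card % 2 := by
    rw [Finset.sum_nat_mod, Finset.sum_congr rfl (fun e _ => M.count_mod S e)]
    simp
  omega

lemma bdry_ne_one {V E : Type*} [Fintype V] [Fintype E] (M : Multigraph V E)
    (hb : ∀ e : E, ¬ M.IsBridge e) (S : Finset V) : (M.bdry S).card ≠ 1 := by
  classical
  intro h
  obtain ⟨e, he⟩ := Finset.card_eq_one.1 h
  have key : ∀ f a b, M.ends f = s(a, b) → f ≠ e → (a ∈ S ↔ b ∈ S) := by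
    intro f a b hf hfe
    have hn : f ∉ M.bdry S := by rw [he]; simpa using hfe
    simp only [bdry, Finset.mem_filter, Finset.mem_univ, true_and] at hn
    push Not at hn
    constructor
    · intro ha
      by_contra hb'
      exact hn a ha b hb' hf
    · intro ha
      by_contra hb'
      exact hn b ha a hb' (by rw [hf, Sym2.eq_swap])
  have hin : e ∈ M.bdry S := by rw [he]; simp
  simp only [bdry, Finset.mem_filter, Finset.mem_univ, true_and] at hin
  obtain ⟨a, ha, b, hbS, hab⟩ := hin
  apply hb e
  intro u v huv hcon
  have hiff : u ∈ S ↔ v ∈ S := by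
    unfold Connects at hcon
    clear huv
    induction hcon with
    | refl => rfl
    | tail _ hs ih =>
      obtain ⟨f, hfe, hf⟩ := hs
      exact ih.trans (key f _ _ hf hfe)
  rw [hab, Sym2.eq_iff] at huv
  grind

lemma three_le_bdry {V E : Type*} [Fintype V] [Fintype E] (M : Multigraph V E)
    (hb : ∀ e : E, ¬ M.IsBridge e) (hc : M.IsCubic) (S : Finset V) (hS : Odd S.card) :
    3 ≤ (M.bdry S).card := by
  have h1 := M.bdry_parity hc S
  have h2 := M.bdry_ne_one hb S
  rw [Nat.odd_iff] at hS
  omega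

/-- The underlying simple graph. -/
def simple {V E : Type*} (M : Multigraph V E) : SimpleGraph V where
  Adj a b := ∃ e, M.ends e = s(a, b)
  symm := ⟨by rintro a b ⟨e, he⟩; exact ⟨e, by rw [he, Sym2.eq_swap]⟩⟩
  loopless := ⟨by rintro a ⟨e, he⟩; exact M.loopless e (by simp [he])⟩

lemma no_violator {V E : Type*} [Fintype V] [Fintype E] (M : Multigraph V E)
    (hb : ∀ e : E, ¬ M.IsBridge e) (hc : M.IsCubic) (U : Set V) :
    ¬ M.simple.IsTutteViolator U := by
  classical
  unfold SimpleGraph.IsTutteViolator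
  rw [not_lt]
  set H := ((⊤ : M.simple.Subgraph).deleteVerts U).coe with hH
  let T : H.ConnectedComponent → Finset V := fun C =>
    (Subtype.val '' C.supp).toFinset
  have hT : ∀ C v, v ∈ T C ↔ ∃ h : v ∈ ((⊤ : M.simple.Subgraph).deleteVerts U).verts,
      H.connectedComponentMk ⟨v, h⟩ = C := by
    intro C v
    simp only [T, Set.mem_toFinset, Set.mem_image, Subtype.exists,
      SimpleGraph.ConnectedComponent.mem_supp_iff]
    grind
  have hTU : ∀ C v, v ∈ T C → v ∉ U := by
    intro C v hv
    obtain ⟨h, -⟩ := (hT C v).1 hv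
    simpa using h
  have hTc : ∀ C v w, v ∈ T C → M.simple.Adj v w → w ∉ U → w ∈ T C := by
    intro C v w hv hvw hw
    obtain ⟨h, rfl⟩ := (hT C v).1 hv
    have hw' : w ∈ ((⊤ : M.simple.Subgraph).deleteVerts U).verts := by simpa using hw
    refine (hT _ w).2 ⟨hw', ?_⟩
    rw [SimpleGraph.ConnectedComponent.eq]
    apply SimpleGraph.Adj.reachable
    have h' : v ∉ U := by simpa using h
    simp [hH, h', hw, hvw.symm]
  have hTd : ∀ C D v, v ∈ T C → v ∈ T D → C = D := by
    intro C D v h1 h2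
    obtain ⟨_, rfl⟩ := (hT C v).1 h1
    obtain ⟨_, rfl⟩ := (hT D v).1 h2
    rfl
  have hTodd : ∀ C ∈ H.oddComponents, Odd (T C).card := by
    intro C hC
    have : (T C).card = C.supp.ncard := by
      rw [← Set.ncard_eq_toFinset_card', Set.ncard_image_of_injective _ Subtype.val_injective]
    rw [this]
    exact hC
  have hbT : ∀ C e, e ∈ M.bdry (T C) → ∃ a ∈ T C, ∃ b ∈ U, M.ends e = s(a, b) := by
    intro C e he
    simp only [bdry, Finset.mem_filter, Finset.mem_univ, true_and] at he
    obtain ⟨a, ha, b, hbS, hab⟩ := he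
    refine ⟨a, ha, b, ?_, hab⟩
    by_contra hbU
    exact hbS (hTc C a b ha ⟨e, hab⟩ hbU)
  have hfin : H.oddComponents.Finite := Set.toFinite _
  have hdisj : (hfin.toFinset : Set H.ConnectedComponent).PairwiseDisjoint
      (fun C => M.bdry (T C)) := by
    intro C _ D _ hCD
    rw [Function.onFun, Finset.disjoint_left]
    intro e h1 h2
    obtain ⟨a, ha, b, hbU, hab⟩ := hbT C e h1
    obtain ⟨c, hc', d, hdU, hcd⟩ := hbT D e h2
    rw [hab, Sym2.eq_iff] at hcd
    rcases hcd with ⟨rfl, rfl⟩ | ⟨rfl, rfl⟩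
    · exact hCD (hTd C D a ha hc')
    · exact hTU _ _ ha hdU
  have hsub : hfin.toFinset.biUnion (fun C => M.bdry (T C)) ⊆ U.toFinset.biUnion M.inc := by
    intro e he
    simp only [Finset.mem_biUnion] at he ⊢
    obtain ⟨C, _, he⟩ := he
    obtain ⟨a, ha, b, hbU, hab⟩ := hbT C e he
    exact ⟨b, by simpa using hbU, by simp [inc, hab]⟩
  have h1 := Finset.card_le_card hsub
  rw [Finset.card_biUnion hdisj] at h1
  have h2 : (U.toFinset.biUnion M.inc).card ≤ U.toFinset.card * 3 :=
    Finset.card_biUnion_le_card_mul _ _ _ (fun v _ => (M.card_inc hc v).le)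
  have h3 : hfin.toFinset.card * 3 ≤ ∑ C ∈ hfin.toFinset, (M.bdry (T C)).card := by
    rw [← smul_eq_mul]
    exact Finset.card_nsmul_le_sum _ _ _ (fun C hC =>
      M.three_le_bdry hb hc _ (hTodd C (by simpa using hC)))
  rw [Set.ncard_eq_toFinset_card _ hfin, Set.ncard_eq_toFinset_card' U]
  omega

end Multigraph

/-- Petersen's theorem: every bridgeless cubic multigraph contains a `2`-factor. -/
theorem bridgeless_cubic_multigraph_has_two_factor {V E : Type*} [Fintype V] [Fintype E]
    (M : Multigraph V E) (hbridgeless : ∀ e : E, ¬ M.IsBridge e) (hcubic : M.IsCubic) :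
    ∃ F : Set E, M.IsTwoFactor F := by
  classical
  obtain ⟨P, hP⟩ := SimpleGraph.tutte.2 (M.no_violator hbridgeless hcubic)
  have hP' := SimpleGraph.Subgraph.isPerfectMatching_iff.1 hP
  have hex : ∀ x : P.edgeSet, ∃ e, M.ends e = x.1 := by
    rintro ⟨x, hx⟩
    induction x using Sym2.ind with
    | _ a b => exact P.adj_sub hx
  choose f hf using hex
  refine ⟨(Set.range f)ᶜ, fun v => ?_⟩
  obtain ⟨w, hw, huniq⟩ := hP' v
  let x : P.edgeSet := ⟨s(v, w), hw⟩
  have hset : {e : E | e ∈ (Set.range f)ᶜ ∧ v ∈ M.ends e} = {e | v ∈ M.ends e} \ {f x} := by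
    ext e
    simp only [Set.mem_setOf_eq, Set.mem_compl_iff, Set.mem_diff, Set.mem_singleton_iff]
    constructor
    · rintro ⟨h1, h2⟩
      exact ⟨h2, fun h => h1 ⟨x, h.symm⟩⟩
    · rintro ⟨h1, h2⟩
      refine ⟨?_, h1⟩
      rintro ⟨⟨y, hy⟩, rfl⟩
      rw [hf] at h1
      obtain ⟨z, rfl⟩ := Sym2.mem_iff_exists.1 h1
      have hz : z = w := huniq z hy
      subst hz
      exact h2 rfl
  have h3 := hcubic v
  unfold Multigraph.degree at h3
  rw [hset, Set.ncard_diff_singleton_of_mem (by simp [hf, x]), h3]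
end

section
/- Let G be an (r-1)-edge-connected, r-regular graph (r > 0) with an even number of vertices, and let H be any set of r-1 edges of G. Then G - H has a perfect matching. -/
open SimpleGraph

/-- A graph is `k`-edge-connected if it is connected and remains connected after removal
of any fewer than `k` edges. -/
def EdgeConnected {V : Type*} (G : SimpleGraph V) (k : ℕ) : Prop :=
  ∀ S : Finset (Sym2 V), S.card < k → (G.deleteEdges ↑S).Connected

/-- Ordered pairs `(u, v)` of adjacent vertices with `u` in `C` and `v` outside. -/
def cutPairs {V : Type*} [Fintype V] [DecidableEq V]
    (G : SimpleGraph V) [DecidableRel G.Adj] (C : Finset V) : Finset (V × V) :=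
  Finset.univ.filter fun p => p.1 ∈ C ∧ p.2 ∉ C ∧ G.Adj p.1 p.2

theorem pairs_card {V : Type*} [Fintype V] [DecidableEq V]
    (G : SimpleGraph V) [DecidableRel G.Adj] (r : ℕ)
    (hreg : G.IsRegularOfDegree r) (C : Finset V) :
    (Finset.univ.filter fun p : V × V => p.1 ∈ C ∧ G.Adj p.1 p.2).card = r * C.card := by
  have h : (Finset.univ.filter fun p : V × V => p.1 ∈ C ∧ G.Adj p.1 p.2)
      = (C.sigma (fun v => G.neighborFinset v)).map
        (Equiv.sigmaEquivProd V V).toEmbedding := by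
    ext ⟨a, b⟩
    simp
  rw [h, Finset.card_map, Finset.card_sigma]
  have : ∀ v ∈ C, (G.neighborFinset v).card = r := fun v _ => by
    rw [G.card_neighborFinset_eq_degree]; exact hreg v
  rw [Finset.sum_congr rfl this]
  simp [mul_comm]

theorem cut_parity {V : Type*} [Fintype V] [DecidableEq V]
    (G : SimpleGraph V) [DecidableRel G.Adj] (r : ℕ)
    (hreg : G.IsRegularOfDegree r) (C : Finset V) :
    ∃ k, r * C.card = 2 * k + (cutPairs G C).card := by
  let K : SimpleGraph V :=
    { Adj := fun u v => u ∈ C ∧ v ∈ C ∧ G.Adj u v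
      symm := ⟨fun u v h => ⟨h.2.1, h.1, h.2.2.symm⟩⟩
      loopless := ⟨fun u h => G.loopless.irrefl u h.2.2⟩ }
  have : DecidableRel K.Adj := fun u v =>
    inferInstanceAs (Decidable (u ∈ C ∧ v ∈ C ∧ G.Adj u v))
  refine ⟨K.edgeFinset.card, ?_⟩
  rw [K.two_mul_card_edgeFinset, ← pairs_card G r hreg C, cutPairs,
    ← Finset.card_union_of_disjoint]
  · congr 1
    ext ⟨a, b⟩
    simp only [Finset.mem_filter, Finset.mem_union, Finset.mem_univ, true_and, K]
    tauto
  · rw [Finset.disjoint_left]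
    rintro ⟨a, b⟩
    simp only [Finset.mem_filter, Finset.mem_univ, true_and, K]
    tauto

theorem cut_lower {V : Type*} [Fintype V] [DecidableEq V]
    (G : SimpleGraph V) [DecidableRel G.Adj] (k : ℕ) (hec : EdgeConnected G k)
    (C : Finset V) (a b : V) (ha : a ∈ C) (hb : b ∉ C) :
    k ≤ (cutPairs G C).card := by
  by_contra! hlt
  have hc := hec ((cutPairs G C).image fun p => s(p.1, p.2))
    (lt_of_le_of_lt Finset.card_image_le hlt)
  obtain ⟨w⟩ := hc.preconnected a b
  obtain ⟨d, -, h1, h2⟩ := w.exists_boundary_dart (C : Set V) ha hb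
  have hd := d.adj
  rw [SimpleGraph.deleteEdges_adj] at hd
  apply hd.2
  simp only [Finset.coe_image, Set.mem_image, Finset.mem_coe]
  exact ⟨(d.fst, d.snd), by simpa [cutPairs] using ⟨h1, h2, hd.1⟩, rfl⟩

theorem edge_pairs {V : Type*} [Fintype V] [DecidableEq V] (H : Finset (Sym2 V)) :
    (Finset.univ.filter fun p : V × V => s(p.1, p.2) ∈ H).card ≤ 2 * H.card := by
  apply Finset.card_le_mul_card_image_of_maps_to (f := fun p : V × V => s(p.1, p.2))
  · intro p hp; simpa using hp
  · intro e _
    induction e with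
    | _ x y =>
      refine le_trans (Finset.card_le_card (t := {(x, y), (y, x)}) ?_) Finset.card_le_two
      rintro ⟨a, b⟩ h
      simp only [Finset.mem_filter, Sym2.eq_iff] at h
      simp only [Finset.mem_insert, Finset.mem_singleton, Prod.mk.injEq]
      tauto

/-- Plesník's theorem: if `G` is an `(r-1)`-edge-connected, `r`-regular graph (`r > 0`)
with an even number of vertices, and `H` is any set of `r-1` edges of `G`, then `G - H`
has a perfect matching. -/
theorem plesnik {V : Type*} [Fintype V] [DecidableEq V]
    (G : SimpleGraph V) [DecidableRel G.Adj] (r : ℕ) (hr : 0 < r)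
    (hreg : G.IsRegularOfDegree r) (hec : EdgeConnected G (r - 1))
    (heven : Even (Fintype.card V))
    (H : Finset (Sym2 V)) (hHsub : ↑H ⊆ G.edgeSet) (hHcard : H.card = r - 1) :
    ∃ M : (G.deleteEdges ↑H).Subgraph, M.IsPerfectMatching := by
  classical
  rw [SimpleGraph.tutte]
  intro S hS
  unfold SimpleGraph.IsTutteViolator at hS
  set T := (⊤ : (G.deleteEdges (H : Set (Sym2 V))).Subgraph).deleteVerts S with hT
  have hverts : T.verts = Sᶜ := by rw [hT]; ext; simp
  have hpar := SimpleGraph.odd_ncard_oddComponents (T.coe)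
  have hcard : Nat.card T.verts + S.ncard = Fintype.card V := by
    rw [Nat.card_coe_set_eq, hverts, add_comm, Set.ncard_add_ncard_compl, Nat.card_eq_fintype_card]
  -- parity gives two extra odd components
  have hS2 : S.ncard + 2 ≤ T.coe.oddComponents.ncard := by
    by_contra! hlt
    have : T.coe.oddComponents.ncard = S.ncard + 1 := by omega
    rw [this] at hpar
    rw [Nat.even_iff] at heven
    rw [Nat.odd_iff, Nat.odd_iff] at hpar
    omega
  let f : T.coe.ConnectedComponent → Finset V := fun c =>
    (Subtype.val '' c.supp : Set V).toFinset
  have hf : ∀ c v, v ∈ f c ↔ ∃ h : v ∈ T.verts, T.coe.connectedComponentMk ⟨v, h⟩ = c := by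
    intro c v
    simp only [f, Set.mem_toFinset, Set.mem_image, Subtype.exists, exists_and_right,
      exists_eq_right, SimpleGraph.ConnectedComponent.mem_supp_iff]
  have hfcard : ∀ c, (f c).card = c.supp.ncard := by
    intro c
    rw [← Set.ncard_image_of_injective _ Subtype.val_injective, Set.ncard_eq_toFinset_card']
  have hlow : ∀ c ∈ T.coe.oddComponents, r ≤ (cutPairs G (f c)).card := by
    intro c hc
    have hodd : Odd (f c).card := by rw [hfcard]; exact hc
    obtain ⟨a, ha⟩ : (f c).Nonempty := Finset.card_pos.mp hodd.pos
    obtain ⟨b, hb⟩ : ∃ b, b ∉ f c := by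
      by_contra! hall
      rw [Finset.eq_univ_of_forall hall, Finset.card_univ] at hodd
      exact (Nat.not_even_iff_odd.mpr hodd) heven
    have h1 := cut_lower G _ hec (f c) a b ha hb
    obtain ⟨k, hk⟩ := cut_parity G r hreg (f c)
    obtain ⟨m, hm⟩ := hodd
    have hk' : 2 * (r * m) + r = 2 * k + (cutPairs G (f c)).card := by
      rw [← hk, hm]; ring
    omega
  let O : Finset T.coe.ConnectedComponent := T.coe.oddComponents.toFinset
  have hO : O.card = T.coe.oddComponents.ncard := by
    rw [Set.ncard_eq_toFinset_card']
  have hdisj : (O : Set T.coe.ConnectedComponent).PairwiseDisjoint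
      fun c => cutPairs G (f c) := by
    intro c _ c' _ hne
    simp only [Function.onFun]
    rw [Finset.disjoint_left]
    intro p hp hp'
    simp only [cutPairs, Finset.mem_filter, hf] at hp hp'
    obtain ⟨-, ⟨_, h⟩, -⟩ := hp
    obtain ⟨-, ⟨_, h'⟩, -⟩ := hp'
    exact hne (h.symm.trans h')
  have hsum : O.card * r ≤ (O.biUnion fun c => cutPairs G (f c)).card := by
    rw [Finset.card_biUnion hdisj, ← smul_eq_mul]
    apply Finset.card_nsmul_le_sum
    intro c hc
    exact hlow c (by simpa [O] using hc)
  have hsub : (O.biUnion fun c => cutPairs G (f c)) ⊆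
      ((Finset.univ.filter fun p : V × V => p.1 ∈ S.toFinset ∧ G.Adj p.1 p.2).image Prod.swap)
      ∪ (Finset.univ.filter fun p : V × V => s(p.1, p.2) ∈ H) := by
    rintro ⟨u, v⟩ hp
    obtain ⟨c, -, hp⟩ := Finset.mem_biUnion.mp hp
    simp only [cutPairs, Finset.mem_filter, Finset.mem_univ, true_and] at hp
    obtain ⟨hu, hv, huv⟩ := hp
    rw [Finset.mem_union]
    by_cases hvS : v ∈ S
    · left
      exact Finset.mem_image.mpr ⟨(v, u), by simpa using ⟨hvS, huv.symm⟩, rfl⟩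
    · right
      by_contra hH
      have hH' : s(u, v) ∉ H := by simpa using hH
      obtain ⟨hu1, hu2⟩ := (hf c u).mp hu
      have hvT : v ∈ T.verts := by rw [hverts]; exact hvS
      apply hv
      rw [hf]
      refine ⟨hvT, ?_⟩
      rw [← hu2, SimpleGraph.ConnectedComponent.eq]
      apply SimpleGraph.Adj.reachable
      have huS : u ∉ S := by rw [hverts] at hu1; exact hu1
      simp only [SimpleGraph.Subgraph.coe_adj, hT, SimpleGraph.Subgraph.deleteVerts_adj]
      simp [huS, hvS, SimpleGraph.deleteEdges_adj, huv.symm, Sym2.eq_swap (a := v), hH']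
  have h1 := Finset.card_le_card hsub
  have h2 := h1.trans (Finset.card_union_le _ _)
  have h3 := pairs_card G r hreg S.toFinset
  have h4 := edge_pairs H
  have h5 := Finset.card_image_le (f := Prod.swap)
    (s := Finset.univ.filter fun p : V × V => p.1 ∈ S.toFinset ∧ G.Adj p.1 p.2)
  rw [h3, ← Set.ncard_eq_toFinset_card'] at h5
  have h6 : (S.ncard + 2) * r ≤ O.card * r := Nat.mul_le_mul_right _ (by omega)
  have h7 : (S.ncard + 2) * r = r * S.ncard + 2 * r := by ring
  omega
end

section
/- For every claw-free cubic graph G, the subdivision S(G) has packing chromatic number at most 5. -/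
open SimpleGraph

/-- The subdivision `S(G)` of `G`: every edge is replaced by a path of length `2`, with
one new vertex inserted per edge. Vertices are `V ⊕ G.edgeSet`; an original vertex is
adjacent to an edge-vertex exactly when it is an endpoint of that edge. -/
def subdivision {V : Type*} (G : SimpleGraph V) : SimpleGraph (V ⊕ G.edgeSet) :=
  SimpleGraph.fromRel (fun a b => ∃ (v : V) (e : G.edgeSet),
    a = Sum.inl v ∧ b = Sum.inr e ∧ v ∈ (e : Sym2 V))

/-- A `(1,2,3,4,5)`-packing coloring of a graph `G`: vertices of color `i ∈ {1,…,5}`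
(represented by `Fin 5`, index `i-1`) are pairwise at distance greater than `i`. -/
def IsColoring12345 {W : Type*} (G : SimpleGraph W) (f : W → Fin 5) : Prop :=
  ∀ u v : W, u ≠ v → f u = f v → ((f u : ℕ) : ℕ∞) + 1 < G.edist u v


namespace ClawFreeProof

variable {V : Type*}

/-- Deleted vertices of equal colour are at distance more than two. -/
def Pk (G : SimpleGraph V) (D : V → Option Bool) : Prop :=
  ∀ u v q, u ≠ v → D u = some q → D v = some q →
    ¬ G.Adj u v ∧ ∀ w, G.Adj u w → ¬ G.Adj v w

/-- Partial construction: `S` is the set of processed vertices, `D` the deleted vertices with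
their colours, `m` an involution giving one matching of the rest; `e` is an exceptional vertex. -/
structure St (G : SimpleGraph V) (S : Set V) (D : V → Option Bool) (m : V → V)
    (e : Option V) : Prop where
  sub : ∀ v, v ∉ S → D v = none
  pack : Pk G D
  closed : ∀ u v w, u ∈ S → G.Adj u v → G.Adj u w → G.Adj v w → v ∈ S
  nb : ∀ v w, D v ≠ none → e ≠ some v → G.Adj v w → w ∈ S
  miss : ∀ v w, v ∈ S → w ∉ S → G.Adj v w →
    ∃ q, D v ≠ some q ∧ ∀ t, G.Adj v t → D t ≠ some q
  minv : ∀ v, m (m v) = v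
  mS : ∀ v, v ∉ S → m v = v
  bip : ∀ v w t, v ∈ S → D v = none → e ≠ some v → G.Adj v w → G.Adj v t → D w = none →
    D t = none → w ≠ m v → t ≠ m v → w = t

structure Tri (G : SimpleGraph V) (x y z p q r : V) : Prop where
  hx : ∀ w, G.Adj x w ↔ w = y ∨ w = z ∨ w = p
  hy : ∀ w, G.Adj y w ↔ w = x ∨ w = z ∨ w = q
  hz : ∀ w, G.Adj z w ↔ w = x ∨ w = y ∨ w = r
  py : ¬ G.Adj p y
  pz : ¬ G.Adj p z
  qx : ¬ G.Adj q x
  qz : ¬ G.Adj q z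
  rx : ¬ G.Adj r x
  ry : ¬ G.Adj r y

structure Dia (G : SimpleGraph V) (a b c d p q : V) : Prop where
  ha : ∀ w, G.Adj a w ↔ w = b ∨ w = c ∨ w = p
  hb : ∀ w, G.Adj b w ↔ w = a ∨ w = c ∨ w = d
  hc : ∀ w, G.Adj c w ↔ w = a ∨ w = b ∨ w = d
  hd : ∀ w, G.Adj d w ↔ w = b ∨ w = c ∨ w = q
  ne : a ≠ d
  pb : p ≠ b
  pc : p ≠ c
  pd : p ≠ d
  qa : q ≠ a
  qb : q ≠ b
  qc : q ≠ c

structure Kf (G : SimpleGraph V) (a b c d : V) : Prop where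
  ha : ∀ w, G.Adj a w ↔ w = b ∨ w = c ∨ w = d
  hb : ∀ w, G.Adj b w ↔ w = a ∨ w = c ∨ w = d
  hc : ∀ w, G.Adj c w ↔ w = a ∨ w = b ∨ w = d
  hd : ∀ w, G.Adj d w ↔ w = a ∨ w = b ∨ w = c

def Nbr (G : SimpleGraph V) (v p q r : V) : Prop :=
  p ≠ q ∧ p ≠ r ∧ q ≠ r ∧ ∀ w, G.Adj v w ↔ w = p ∨ w = q ∨ w = r

theorem nbr_exists [Fintype V] [DecidableEq V] (G : SimpleGraph V) [DecidableRel G.Adj]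
    (hcubic : ∀ v : V, G.degree v = 3) (v : V) : ∃ p q r, Nbr G v p q r := by
  have h := hcubic v
  rw [← SimpleGraph.card_neighborFinset_eq_degree, Finset.card_eq_three] at h
  obtain ⟨p, q, r, h1, h2, h3, h4⟩ := h
  refine ⟨p, q, r, h1, h2, h3, fun w => ?_⟩
  rw [← SimpleGraph.mem_neighborFinset, h4]
  simp

/-- If two neighbours are known, find the third. -/
theorem nbr_two {G : SimpleGraph V} (hN : ∀ v, ∃ p q r, Nbr G v p q r) {v a b : V}
    (ha : G.Adj v a) (hb : G.Adj v b) (hab : a ≠ b) : ∃ c, Nbr G v a b c := by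
  obtain ⟨p, q, r, h1, h2, h3, h4⟩ := hN v
  have h5 := (h4 a).1 ha
  have h6 := (h4 b).1 hb
  unfold Nbr
  rcases h5 with rfl | rfl | rfl <;> rcases h6 with rfl | rfl | rfl
  · exact absurd rfl hab
  · exact ⟨r, by grind⟩
  · exact ⟨q, by grind⟩
  · exact ⟨r, by grind⟩
  · exact absurd rfl hab
  · exact ⟨p, by grind⟩
  · exact ⟨q, by grind⟩
  · exact ⟨p, by grind⟩
  · exact absurd rfl hab

theorem classify_aux {G : SimpleGraph V} (hN : ∀ v, ∃ p q r, Nbr G v p q r) {v p q r : V}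
    (h : Nbr G v p q r) (hpq : G.Adj p q) :
    (∃ y z p q r, Tri G v y z p q r) ∨ (∃ b c d p q, Dia G v b c d p q) ∨
    (∃ a c d p q, Dia G a v c d p q) ∨ (∃ b c d, Kf G v b c d) := by
  have hmid : ∀ p q r, Nbr G v p q r → G.Adj p q → G.Adj p r → ¬ G.Adj q r →
      (∃ a c d p q, Dia G a v c d p q) := by
    intro p q r ⟨h1, h2, h3, h4⟩ hpq hpr hqr
    have hvp := (h4 p).2 (by simp)
    have hvq := (h4 q).2 (by simp)
    have hvr := (h4 r).2 (by simp)
    obtain ⟨s, hs⟩ := nbr_two hN hvq.symm hpq.symm hvp.ne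
    obtain ⟨t, ht⟩ := nbr_two hN hvr.symm hpr.symm hvp.ne
    obtain ⟨u, hu⟩ := nbr_two hN hvp.symm hpq hvq.ne
    obtain ⟨_, _, _, hs⟩ := hs
    obtain ⟨_, _, _, ht⟩ := ht
    obtain ⟨_, _, _, hu⟩ := hu
    have := hvr.ne
    have : r = u := by grind
    subst this
    have hqs := (hs s).2 (by simp)
    have hrt := (ht t).2 (by simp)
    have := fun h : G.Adj r q => hqr h.symm
    refine ⟨q, p, r, s, t, ?_⟩
    constructor <;> grind
  by_cases hpr : G.Adj p r
  · by_cases hqr : G.Adj q r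
    · right; right; right
      obtain ⟨h1, h2, h3, h4⟩ := h
      have hvp := (h4 p).2 (by simp)
      have hvq := (h4 q).2 (by simp)
      have hvr := (h4 r).2 (by simp)
      obtain ⟨s, hs⟩ := nbr_two hN hvq.symm hpq.symm hvp.ne
      obtain ⟨t, ht⟩ := nbr_two hN hvr.symm hpr.symm hvp.ne
      obtain ⟨u, hu⟩ := nbr_two hN hvp.symm hpq hvq.ne
      obtain ⟨_, _, _, hs⟩ := hs
      obtain ⟨_, _, _, ht⟩ := ht
      obtain ⟨_, _, _, hu⟩ := hu
      have := hvr.ne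
      have := hqr.symm
      refine ⟨p, q, r, ?_⟩
      constructor <;> grind
    · exact Or.inr (Or.inr (Or.inl (hmid p q r h hpq hpr hqr)))
  · by_cases hqr : G.Adj q r
    · refine Or.inr (Or.inr (Or.inl (hmid q p r ?_ hpq.symm hqr hpr)))
      obtain ⟨h1, h2, h3, h4⟩ := h
      exact ⟨h1.symm, h3, h2, by grind⟩
    · obtain ⟨h1, h2, h3, h4⟩ := h
      have hvp := (h4 p).2 (by simp)
      have hvq := (h4 q).2 (by simp)
      have hvr := (h4 r).2 (by simp)
      obtain ⟨s, _, _, _, hs⟩ := nbr_two hN hvp.symm hpq hvq.ne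
      obtain ⟨t, _, _, _, ht⟩ := nbr_two hN hvq.symm hpq.symm hvp.ne
      have hps := (hs s).2 (by simp)
      have hqt := (ht t).2 (by simp)
      have hsym : ∀ a b, G.Adj a b → G.Adj b a := fun a b h => h.symm
      have hirr : ∀ a, ¬ G.Adj a a := fun a => G.irrefl
      by_cases hst : s = t
      · subst hst
        right; left
        obtain ⟨u, _, _, _, hu⟩ := nbr_two hN hps.symm hqt.symm hpq.ne
        have hsu := (hu u).2 (by simp)
        refine ⟨p, q, s, r, u, ?_⟩
        constructor <;> grind
      · left
        refine ⟨p, q, r, s, t, ?_⟩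
        constructor <;> grind

theorem classify {G : SimpleGraph V} (hN : ∀ v, ∃ p q r, Nbr G v p q r) (hc : IsClawFree G)
    (v : V) :
    (∃ y z p q r, Tri G v y z p q r) ∨ (∃ b c d p q, Dia G v b c d p q) ∨
    (∃ a c d p q, Dia G a v c d p q) ∨ (∃ b c d, Kf G v b c d) := by
  obtain ⟨p, q, r, h⟩ := hN v
  have h' := h
  obtain ⟨h1, h2, h3, h4⟩ := h'
  by_cases hpq : G.Adj p q
  · exact classify_aux hN h hpq
  by_cases hpr : G.Adj p r
  · refine classify_aux hN (q := r) (r := q) ⟨h2, h1, h3.symm, by grind⟩ hpr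
  by_cases hqr : G.Adj q r
  · refine classify_aux hN (p := q) (q := r) (r := p) ⟨h3, h1.symm, h2.symm, by grind⟩ hqr
  exact absurd ⟨v, p, q, r, h1, h2, h3, (h4 p).2 (by simp), (h4 q).2 (by simp),
    (h4 r).2 (by simp), hpq, hpr, hqr⟩ hc

/-- A vertex of a closed set has at most one outside neighbour. -/
theorem St.one {G : SimpleGraph V} (hN : ∀ v, ∃ p q r, Nbr G v p q r) (hc : IsClawFree G)
    {S D m e} (h : St G S D m e) {v x y : V} (hv : v ∈ S) (hx : x ∉ S) (hy : y ∉ S)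
    (hvx : G.Adj v x) (hvy : G.Adj v y) : x = y := by
  by_contra hxy
  obtain ⟨t, h1, h2, h3, h4⟩ := nbr_two hN hvx hvy hxy
  have hvt := (h4 t).2 (by simp)
  have e1 : ¬ G.Adj x y := fun h' => hx (h.closed v x y hv hvx hvy h')
  have e2 : ¬ G.Adj x t := fun h' => hx (h.closed v x t hv hvx hvt h')
  have e3 : ¬ G.Adj y t := fun h' => hy (h.closed v y t hv hvy hvt h')
  exact hc ⟨v, x, y, t, h1, h2, h3, hvx, hvy, hvt, e1, e2, e3⟩

variable [DecidableEq V]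

def swp (m : V → V) (y z : V) : V → V := fun v => if v = y then z else if v = z then y else m v

def upd (D : V → Option Bool) (x : V) (k : Bool) : V → Option Bool :=
  fun v => if v = x then some k else D v

theorem swp_inv {m : V → V} {y z : V} (h : ∀ v, m (m v) = v) (hy : m y = y) (hz : m z = z) :
    ∀ v, swp m y z (swp m y z v) = v := by
  intro v
  have := h v
  unfold swp
  grind

theorem pk_upd {G : SimpleGraph V} {D : V → Option Bool} {x : V} {k : Bool} (h : Pk G D)
    (hx : ∀ u, D u = some k → ¬ G.Adj x u ∧ ∀ w, G.Adj x w → ¬ G.Adj u w) :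
    Pk G (upd D x k) := by
  intro u v q huv hu hv
  unfold upd at hu hv
  by_cases h1 : u = x
  · have h2 : v ≠ x := fun h => huv (h1.trans h.symm)
    rw [if_pos h1] at hu
    rw [if_neg h2] at hv
    obtain rfl : k = q := by simpa using hu
    subst h1
    exact hx v hv
  · rw [if_neg h1] at hu
    by_cases h2 : v = x
    · rw [if_pos h2] at hv
      obtain rfl : k = q := by simpa using hv
      subst h2
      obtain ⟨h3, h4⟩ := hx u hu
      exact ⟨fun h => h3 h.symm, fun w hw hw' => h4 w hw' hw⟩
    · rw [if_neg h2] at hv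
      exact h u v q huv hu hv

theorem extT {G : SimpleGraph V} (hN : ∀ v, ∃ p q r, Nbr G v p q r) (hc : IsClawFree G)
    {S D m} {e : Option V} {v0 x y z q r : V} (h : St G S D m e) (he : e = none ∨ e = some v0)
    (hv0 : v0 ∈ S) (hx : x ∉ S) (t : Tri G x y z v0 q r)
    (hE : e = some v0 → D v0 = none → ∀ w t, G.Adj v0 w → G.Adj v0 t → D w = none →
      D t = none → w ≠ x → t ≠ x → w = t) :
    ∃ S' D' m', St G S' D' m' none ∧ S ⊂ S' := by
  have hone := fun x y => @St.one V G hN hc S D m e h v0 x y hv0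
  clear hN hc
  have hsym : ∀ a b, G.Adj a b → G.Adj b a := fun a b h => h.symm
  have hirr : ∀ a, ¬ G.Adj a a := fun a => G.irrefl
  obtain ⟨sub, pack, closed, nb, miss, minv, mS, bip⟩ := h
  obtain ⟨hx', hy', hz', py, pz, qx, qz, rx, ry⟩ := t
  have hxy := (hx' y).2 (by simp)
  have hxz := (hx' z).2 (by simp)
  have hx0 := (hx' v0).2 (by simp)
  have hyq := (hy' q).2 (by simp)
  have hzr := (hz' r).2 (by simp)
  have hyz := (hy' z).2 (by simp)
  have hyS : y ∉ S := fun h => hx (closed y x z h hxy.symm hyz hxz)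
  have hzS : z ∉ S := fun h => hx (closed z x y h hxz.symm hyz.symm hxy)
  have hD : ∀ u w, w ∉ S → G.Adj u w → u ≠ v0 → D u = none := by
    intro u w hw huw hu
    by_contra hh
    exact hw (nb u w hh (by grind) huw)
  have hD' : ∀ u, u ∉ S → ∀ w, G.Adj u w → w ≠ v0 → D w = none :=
    fun u hu w hw hw0 => hD w u hu hw.symm hw0
  have hxD := sub x hx
  have hyD := sub y hyS
  have hzD := sub z hzS
  have hqD := hD q y hyS hyq.symm (fun h => py (h ▸ hyq.symm))
  have hrD := hD r z hzS hzr.symm (fun h => pz (h ▸ hzr.symm))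
  obtain ⟨k, hk1, hk2⟩ := miss v0 x hv0 hx hx0.symm
  refine ⟨S ∪ {x, y, z}, upd D x k, swp m y z, ?_, ?_⟩
  · constructor
    · clear bip miss pack closed nb
      unfold upd
      grind
    · refine pk_upd pack fun u hu => ⟨?_, ?_⟩
      · clear bip miss pack closed nb hone
        grind
      · clear bip miss pack closed nb hone
        grind
    · clear bip miss pack nb hD hD' sub
      intro u v w hu huv huw hvw
      by_cases huS : u ∈ S
      · exact Or.inl (closed u v w huS huv huw hvw)
      · clear closed hone
        grind
    · intro v w hv _ hvw
      clear bip miss pack hD hD' sub closed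
      unfold upd at hv
      by_cases hvx : v = x
      · grind
      · by_cases hv0 : v = v0
        · subst hv0
          by_contra hw
          have := hone x w hx (fun h => hw (Or.inl h)) hx0.symm hvw
          grind
        · rw [if_neg hvx] at hv
          exact Or.inl (nb v w hv (by grind) hvw)
    · intro v w hv hw hvw
      clear bip pack sub closed nb
      unfold upd
      by_cases hvS : v ∈ S
      · have hv0 : v ≠ v0 := by
          rintro rfl
          have := hone x w hx (fun h => hw (Or.inl h)) hx0.symm hvw
          grind
        obtain ⟨j, hj, hj'⟩ := miss v w hvS (fun h => hw (Or.inl h)) hvw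
        refine ⟨j, by grind, ?_⟩
        clear miss hone
        grind
      · refine ⟨!k, ?_⟩
        clear miss hone hk1 hk2
        grind
    · exact swp_inv minv (mS y hyS) (mS z hzS)
    · clear bip miss pack closed nb hone hD hD'
      unfold swp
      grind
    · intro v w t hv hvD _ hvw hvt hw ht hwm htm
      clear miss pack closed nb sub hone hk1 hk2
      unfold upd at hvD hw ht
      unfold swp at hwm htm
      by_cases hvS : v ∈ S
      · by_cases hve : e = some v
        · obtain rfl : v = v0 := by grind
          have hvx : v ≠ x := fun h => hx (h ▸ hvS)
          rw [if_neg hvx] at hvD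
          refine hE hve hvD w t hvw hvt ?_ ?_ ?_ ?_ <;> clear bip hD hD' hE <;> grind
        · refine bip v w t hvS ?_ hve hvw hvt ?_ ?_ ?_ ?_ <;> clear bip hD hD' <;> grind
      · clear bip hD hD'
        grind
  · refine ⟨by grind, fun hh => hx (hh (by simp))⟩

theorem extD {G : SimpleGraph V} (hN : ∀ v, ∃ p q r, Nbr G v p q r) (hc : IsClawFree G)
    {S D m} {e : Option V} {v0 x b c d q : V} (h : St G S D m e) (he : e = none ∨ e = some v0)
    (hv0 : v0 ∈ S) (hx : x ∉ S) (t : Dia G x b c d v0 q) (hv0D : D v0 = none)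
    (hE : e = some v0 → ∀ w t, G.Adj v0 w → G.Adj v0 t → D w = none →
      D t = none → w ≠ x → t ≠ x → w = t) :
    ∃ S' D' m', St G S' D' m' none ∧ S ⊂ S' := by
  have hone := fun x y => @St.one V G hN hc S D m e h v0 x y hv0
  clear hN hc
  have hsym : ∀ a b, G.Adj a b → G.Adj b a := fun a b h => h.symm
  have hirr : ∀ a, ¬ G.Adj a a := fun a => G.irrefl
  obtain ⟨sub, pack, closed, nb, miss, minv, mS, bip⟩ := h
  obtain ⟨ha', hb', hc', hd', ne, pb, pc, pd, qa, qb, qc⟩ := t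
  have hxb := (ha' b).2 (by simp)
  have hxc := (ha' c).2 (by simp)
  have hx0 := (ha' v0).2 (by simp)
  have hbc := (hb' c).2 (by simp)
  have hbd := (hb' d).2 (by simp)
  have hcd := (hc' d).2 (by simp)
  have hdq := (hd' q).2 (by simp)
  have hbS : b ∉ S := fun h => hx (closed b x c h hxb.symm hbc hxc)
  have hcS : c ∉ S := fun h => hx (closed c x b h hxc.symm hbc.symm hxb)
  have hdS : d ∉ S := fun h => hbS (closed d b c h hbd.symm hcd.symm hbc)
  have hD : ∀ u w, w ∉ S → G.Adj u w → D u = none := by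
    intro u w hw huw
    by_contra hh
    exact hw (nb u w hh (by grind) huw)
  have hD' : ∀ u, u ∉ S → ∀ w, G.Adj u w → D w = none :=
    fun u hu w hw => hD w u hu hw.symm
  have hxD := sub x hx
  have hbD := sub b hbS
  have hcD := sub c hcS
  have hdD := sub d hdS
  have hqD := hD q d hdS hdq.symm
  obtain ⟨k, hk1, hk2⟩ := miss v0 x hv0 hx hx0.symm
  refine ⟨S ∪ {x, b, c, d}, upd (upd D x k) b (!k), swp m c d, ?_, ?_⟩
  · constructor
    · clear bip miss pack closed nb
      unfold upd
      grind
    · refine pk_upd (pk_upd pack fun u hu => ⟨?_, ?_⟩) fun u hu => ⟨?_, ?_⟩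
      · clear bip miss pack closed nb hone
        grind
      · clear bip miss pack closed nb hone
        grind
      · clear bip miss pack closed nb hone
        unfold upd at hu
        grind
      · clear bip miss pack closed nb hone
        unfold upd at hu
        grind
    · clear bip miss pack nb hD hD' sub
      intro u v w hu huv huw hvw
      by_cases huS : u ∈ S
      · exact Or.inl (closed u v w huS huv huw hvw)
      · clear closed hone
        grind
    · intro v w hv _ hvw
      clear bip miss pack hD hD' sub closed
      unfold upd at hv
      by_cases hvx : v = x
      · grind
      by_cases hvb : v = b
      · grind
      · by_cases hv0 : v = v0
        · subst hv0
          by_contra hw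
          have := hone x w hx (fun h => hw (Or.inl h)) hx0.symm hvw
          grind
        · rw [if_neg hvb, if_neg hvx] at hv
          exact Or.inl (nb v w hv (by grind) hvw)
    · intro v w hv hw hvw
      clear bip pack sub closed nb
      unfold upd
      by_cases hvS : v ∈ S
      · have hv0 : v ≠ v0 := by
          rintro rfl
          have := hone x w hx (fun h => hw (Or.inl h)) hx0.symm hvw
          grind
        obtain ⟨j, hj, hj'⟩ := miss v w hvS (fun h => hw (Or.inl h)) hvw
        refine ⟨j, by grind, ?_⟩
        clear miss hone
        grind
      · refine ⟨k, ?_⟩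
        clear miss hone hk1 hk2
        grind
    · exact swp_inv minv (mS c hcS) (mS d hdS)
    · clear bip miss pack closed nb hone hD hD'
      unfold swp
      grind
    · intro v w t hv hvD _ hvw hvt hw ht hwm htm
      clear miss pack closed nb sub hone hk1 hk2
      unfold upd at hvD hw ht
      unfold swp at hwm htm
      by_cases hvS : v ∈ S
      · by_cases hve : e = some v
        · obtain rfl : v = v0 := by grind
          have hvx : v ≠ x := fun h => hx (h ▸ hvS)
          refine hE hve w t hvw hvt ?_ ?_ ?_ ?_ <;> clear bip hD hD' hE <;> grind
        · refine bip v w t hvS ?_ hve hvw hvt ?_ ?_ ?_ ?_ <;> clear bip hD hD' <;> grind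
      · clear bip hD hD'
        grind
  · refine ⟨by grind, fun hh => hx (hh (by simp))⟩

theorem rootK {G : SimpleGraph V}
    {S D m} {a b c d : V} (h : St G S D m none) (ha : a ∉ S) (t : Kf G a b c d) :
    ∃ S' D' m', St G S' D' m' none ∧ S ⊂ S' := by
  have hsym : ∀ a b, G.Adj a b → G.Adj b a := fun a b h => h.symm
  have hirr : ∀ a, ¬ G.Adj a a := fun a => G.irrefl
  obtain ⟨sub, pack, closed, nb, miss, minv, mS, bip⟩ := h
  obtain ⟨ha', hb', hc', hd'⟩ := t
  have hab := (ha' b).2 (by simp)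
  have hac := (ha' c).2 (by simp)
  have had := (ha' d).2 (by simp)
  have hbc := (hb' c).2 (by simp)
  have hbd := (hb' d).2 (by simp)
  have hcd := (hc' d).2 (by simp)
  have hbS : b ∉ S := fun h => ha (closed b a c h hab.symm hbc hac)
  have hcS : c ∉ S := fun h => ha (closed c a b h hac.symm hbc.symm hab)
  have hdS : d ∉ S := fun h => hbS (closed d b c h hbd.symm hcd.symm hbc)
  have haD := sub a ha
  have hbD := sub b hbS
  have hcD := sub c hcS
  have hdD := sub d hdS
  refine ⟨S ∪ {a, b, c, d}, upd (upd D a false) b true, swp m c d, ?_, ?_⟩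
  · constructor
    · clear bip miss pack closed nb
      unfold upd
      grind
    · refine pk_upd (pk_upd pack fun u hu => ⟨?_, ?_⟩) fun u hu => ⟨?_, ?_⟩
      · clear bip miss pack closed nb
        grind
      · clear bip miss pack closed nb
        grind
      · clear bip miss pack closed nb
        unfold upd at hu
        grind
      · clear bip miss pack closed nb
        unfold upd at hu
        grind
    · clear bip miss pack nb sub
      intro u v w hu huv huw hvw
      by_cases huS : u ∈ S
      · exact Or.inl (closed u v w huS huv huw hvw)
      · clear closed
        grind
    · intro v w hv _ hvw
      clear bip miss pack sub closed
      unfold upd at hv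
      by_cases hva : v = a
      · grind
      by_cases hvb : v = b
      · grind
      rw [if_neg hvb, if_neg hva] at hv
      exact Or.inl (nb v w hv (by simp) hvw)
    · intro v w hv hw hvw
      clear bip pack sub closed nb
      unfold upd
      by_cases hvS : v ∈ S
      · obtain ⟨j, hj, hj'⟩ := miss v w hvS (fun h => hw (Or.inl h)) hvw
        refine ⟨j, by grind, ?_⟩
        clear miss
        grind
      · clear miss
        grind
    · exact swp_inv minv (mS c hcS) (mS d hdS)
    · clear bip miss pack closed nb
      unfold swp
      grind
    · intro v w t hv hvD _ hvw hvt hw ht hwm htm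
      clear miss pack closed nb sub
      unfold upd at hvD hw ht
      unfold swp at hwm htm
      by_cases hvS : v ∈ S
      · refine bip v w t hvS ?_ (by simp) hvw hvt ?_ ?_ ?_ ?_ <;> clear bip <;> grind
      · clear bip
        grind
  · refine ⟨by grind, fun hh => ha (hh (by simp))⟩

/-- Start with a diamond; its end `a` is exceptional. -/
theorem rootD {G : SimpleGraph V}
    {S D m} {a b c d p q : V} (h : St G S D m none) (ha : a ∉ S) (t : Dia G a b c d p q) :
    St G (S ∪ {a, b, c, d}) (upd D b false) (swp m c d) (some a) := by
  have hsym : ∀ a b, G.Adj a b → G.Adj b a := fun a b h => h.symm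
  have hirr : ∀ a, ¬ G.Adj a a := fun a => G.irrefl
  obtain ⟨sub, pack, closed, nb, miss, minv, mS, bip⟩ := h
  obtain ⟨ha', hb', hc', hd', ne, pb, pc, pd, qa, qb, qc⟩ := t
  have hab := (ha' b).2 (by simp)
  have hac := (ha' c).2 (by simp)
  have hap := (ha' p).2 (by simp)
  have hbc := (hb' c).2 (by simp)
  have hbd := (hb' d).2 (by simp)
  have hcd := (hc' d).2 (by simp)
  have hdq := (hd' q).2 (by simp)
  have hbS : b ∉ S := fun h => ha (closed b a c h hab.symm hbc hac)
  have hcS : c ∉ S := fun h => ha (closed c a b h hac.symm hbc.symm hab)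
  have hdS : d ∉ S := fun h => hbS (closed d b c h hbd.symm hcd.symm hbc)
  have hD : ∀ u w, w ∉ S → G.Adj u w → D u = none := by
    intro u w hw huw
    by_contra hh
    exact hw (nb u w hh (by simp) huw)
  have haD := sub a ha
  have hbD := sub b hbS
  have hcD := sub c hcS
  have hdD := sub d hdS
  have hqD := hD q d hdS hdq.symm
  have hpD := hD p a ha hap.symm
  constructor
  · clear bip miss pack closed nb
    unfold upd
    grind
  · refine pk_upd pack fun u hu => ⟨?_, ?_⟩
    · clear bip miss pack closed nb
      grind
    · clear bip miss pack closed nb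
      grind
  · clear bip miss pack nb hD sub
    intro u v w hu huv huw hvw
    by_cases huS : u ∈ S
    · exact Or.inl (closed u v w huS huv huw hvw)
    · clear closed
      grind
  · intro v w hv _ hvw
    clear bip miss pack hD sub closed
    unfold upd at hv
    by_cases hvb : v = b
    · grind
    · rw [if_neg hvb] at hv
      exact Or.inl (nb v w hv (by simp) hvw)
  · intro v w hv hw hvw
    clear bip pack sub closed nb
    unfold upd
    by_cases hvS : v ∈ S
    · obtain ⟨j, hj, hj'⟩ := miss v w hvS (fun h => hw (Or.inl h)) hvw
      refine ⟨j, by grind, ?_⟩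
      clear miss
      grind
    · refine ⟨true, ?_⟩
      clear miss
      grind
  · exact swp_inv minv (mS c hcS) (mS d hdS)
  · clear bip miss pack closed nb hD
    unfold swp
    grind
  · intro v w t hv hvD hva hvw hvt hw ht hwm htm
    clear miss pack closed nb sub
    unfold upd at hvD hw ht
    unfold swp at hwm htm
    by_cases hvS : v ∈ S
    · refine bip v w t hvS ?_ (by simp) hvw hvt ?_ ?_ ?_ ?_ <;> clear bip hD <;> grind
    · clear bip hD
      grind

/-- Start with a triangle; its deleted vertex `x` is exceptional. -/
theorem rootT {G : SimpleGraph V}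
    {S D m} {x y z p q r : V} (h : St G S D m none) (hx : x ∉ S) (hp : p ∉ S)
    (t : Tri G x y z p q r) :
    St G (S ∪ {x, y, z}) (upd D x false) (swp m y z) (some x) := by
  have hsym : ∀ a b, G.Adj a b → G.Adj b a := fun a b h => h.symm
  have hirr : ∀ a, ¬ G.Adj a a := fun a => G.irrefl
  obtain ⟨sub, pack, closed, nb, miss, minv, mS, bip⟩ := h
  obtain ⟨hx', hy', hz', py, pz, qx, qz, rx, ry⟩ := t
  have hxy := (hx' y).2 (by simp)
  have hxz := (hx' z).2 (by simp)
  have hxp := (hx' p).2 (by simp)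
  have hyq := (hy' q).2 (by simp)
  have hzr := (hz' r).2 (by simp)
  have hyz := (hy' z).2 (by simp)
  have hyS : y ∉ S := fun h => hx (closed y x z h hxy.symm hyz hxz)
  have hzS : z ∉ S := fun h => hx (closed z x y h hxz.symm hyz.symm hxy)
  have hD : ∀ u w, w ∉ S → G.Adj u w → D u = none := by
    intro u w hw huw
    by_contra hh
    exact hw (nb u w hh (by simp) huw)
  have hxD := sub x hx
  have hyD := sub y hyS
  have hzD := sub z hzS
  have hpD := sub p hp
  have hqD := hD q y hyS hyq.symm
  have hrD := hD r z hzS hzr.symm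
  constructor
  · clear bip miss pack closed nb
    unfold upd
    grind
  · refine pk_upd pack fun u hu => ⟨?_, ?_⟩
    · clear bip miss pack closed nb
      grind
    · clear bip miss pack closed nb
      grind
  · clear bip miss pack nb hD sub
    intro u v w hu huv huw hvw
    by_cases huS : u ∈ S
    · exact Or.inl (closed u v w huS huv huw hvw)
    · clear closed
      grind
  · intro v w hv _ hvw
    clear bip miss pack hD sub closed
    unfold upd at hv
    by_cases hvb : v = x
    · grind
    · rw [if_neg hvb] at hv
      exact Or.inl (nb v w hv (by simp) hvw)
  · intro v w hv hw hvw
    clear bip pack sub closed nb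
    unfold upd
    by_cases hvS : v ∈ S
    · obtain ⟨j, hj, hj'⟩ := miss v w hvS (fun h => hw (Or.inl h)) hvw
      refine ⟨j, by grind, ?_⟩
      clear miss
      grind
    · refine ⟨true, ?_⟩
      clear miss
      grind
  · exact swp_inv minv (mS y hyS) (mS z hzS)
  · clear bip miss pack closed nb hD
    unfold swp
    grind
  · intro v w t hv hvD hva hvw hvt hw ht hwm htm
    clear miss pack closed nb sub
    unfold upd at hvD hw ht
    unfold swp at hwm htm
    by_cases hvS : v ∈ S
    · refine bip v w t hvS ?_ (by simp) hvw hvt ?_ ?_ ?_ ?_ <;> clear bip hD <;> grind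
    · clear bip hD
      grind

theorem ext {G : SimpleGraph V} (hN : ∀ v, ∃ p q r, Nbr G v p q r) (hc : IsClawFree G)
    {S D m} {e : Option V} {v0 x : V} (h : St G S D m e) (he : e = none ∨ e = some v0)
    (hv0 : v0 ∈ S) (hx : x ∉ S) (hadj : G.Adj v0 x)
    (hd : D v0 = none ∨ ¬ ∃ b c d p q, Dia G x b c d p q)
    (hE : e = some v0 → D v0 = none → ∀ w t, G.Adj v0 w → G.Adj v0 t → D w = none →
      D t = none → w ≠ x → t ≠ x → w = t) :
    ∃ S' D' m', St G S' D' m' none ∧ S ⊂ S' := by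
  have key : ∀ w, G.Adj v0 w → G.Adj x w → False := fun w h1 h2 =>
    hx (h.closed v0 x w hv0 hadj h1 h2)
  have hsym : ∀ a b, G.Adj a b → G.Adj b a := fun a b h => h.symm
  rcases classify hN hc x with ⟨y, z, p, q, r, t⟩ | ⟨b, c, d, p, q, t⟩ | ⟨a, c, d, p, q, t⟩ |
    ⟨b, c, d, t⟩
  · obtain rfl : v0 = p := by
      obtain ⟨h1, h2, h3, -, -, -, -, -, -⟩ := t
      have := (h1 y).2 (by simp)
      have := (h1 z).2 (by simp)
      have := (h2 z).2 (by simp)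
      have := (h1 v0).1 hadj.symm
      clear hE h
      grind
    exact extT hN hc h he hv0 hx t hE
  · rcases hd with hd | hd
    · obtain rfl : v0 = p := by
        obtain ⟨h1, h2, h3, -, -, -, -, -, -⟩ := t
        have := (h1 b).2 (by simp)
        have := (h1 c).2 (by simp)
        have := (h2 c).2 (by simp)
        have := (h1 v0).1 hadj.symm
        clear hE h
        grind
      exact extD hN hc h he hv0 hx t hd (fun h => hE h hd)
    · exact absurd ⟨b, c, d, p, q, t⟩ hd
  · exfalso
    obtain ⟨h1, h2, h3, h4, -, -, -, -, -⟩ := t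
    rcases (h2 v0).1 hadj.symm with rfl | rfl | rfl
    · exact key c ((h1 c).2 (by simp)) ((h2 c).2 (by simp))
    · exact key a ((h3 a).2 (by simp)) ((h2 a).2 (by simp))
    · exact key c ((h4 c).2 (by simp)) ((h2 c).2 (by simp))
  · exfalso
    obtain ⟨h1, h2, h3, h4⟩ := t
    rcases (h1 v0).1 hadj.symm with rfl | rfl | rfl
    · exact key c ((h2 c).2 (by simp)) ((h1 c).2 (by simp))
    · exact key b ((h3 b).2 (by simp)) ((h1 b).2 (by simp))
    · exact key b ((h4 b).2 (by simp)) ((h1 b).2 (by simp))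

theorem step {G : SimpleGraph V} (hN : ∀ v, ∃ p q r, Nbr G v p q r) (hc : IsClawFree G)
    {S D m} (h : St G S D m none) (hS : ∃ v, v ∉ S) :
    ∃ S' D' m', St G S' D' m' none ∧ S ⊂ S' := by
  by_cases hA : ∃ v0 x, v0 ∈ S ∧ x ∉ S ∧ G.Adj v0 x
  · obtain ⟨v0, x, hv0, hx, hadj⟩ := hA
    refine ext hN hc h (Or.inl rfl) hv0 hx hadj (Or.inl ?_) (by simp)
    by_contra hh
    exact hx (h.nb v0 x hh (by simp) hadj)
  have hB : ∀ u w, G.Adj u w → u ∉ S → w ∉ S := by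
    intro u w huw hu hw
    exact hA ⟨w, u, hw, hu, huw.symm⟩
  have hirr : ∀ a, ¬ G.Adj a a := fun a => G.irrefl
  by_cases hC : ∃ a b c d p q, a ∉ S ∧ Dia G a b c d p q
  · obtain ⟨a, b, c, d, p, q, ha, t⟩ := hC
    have h' := rootD h ha t
    have haD := h.sub a ha
    obtain ⟨h1, h2, h3, h4, ne, pb, pc, pd, -, -, -⟩ := t
    have hap := (h1 p).2 (by simp)
    have hab := (h1 b).2 (by simp)
    have hpS := hB a p hap ha
    have hap' := hap.ne
    have hab' := hab.ne
    obtain ⟨S', D', m', h5, h6⟩ := ext hN hc h' (Or.inr rfl) (x := p) (by simp) (by grind) hap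
      (Or.inl (by unfold upd; grind)) (by
        intro _ _ w t hw ht hw1 ht1 hwp htp
        unfold upd at hw1 ht1
        grind)
    exact ⟨S', D', m', h5, lt_of_le_of_lt Set.subset_union_left h6⟩
  · obtain ⟨v, hv⟩ := hS
    rcases classify hN hc v with ⟨y, z, p, q, r, t⟩ | ⟨b, c, d, p, q, t⟩ | ⟨a, c, d, p, q, t⟩ |
      ⟨b, c, d, t⟩
    · have hp := (t.hx p).2 (by simp)
      have hpS := hB v p hp hv
      have h' := rootT h hv hpS t
      have hpy : p ≠ y := by
        rintro rfl
        exact t.pz ((t.hy z).2 (by simp))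
      have hpz : p ≠ z := by
        rintro rfl
        exact t.py ((t.hz y).2 (by simp))
      have hpv := hp.ne
      obtain ⟨S', D', m', h5, h6⟩ := ext hN hc h' (Or.inr rfl) (x := p) (by simp) (by grind) hp
        (Or.inr (fun ⟨b, c, d, p', q', h'⟩ => hC ⟨p, b, c, d, p', q', hpS, h'⟩)) (by
          intro _ h
          simp [upd] at h)
      exact ⟨S', D', m', h5, lt_of_le_of_lt Set.subset_union_left h6⟩
    · exact absurd ⟨v, b, c, d, p, q, hv, t⟩ hC
    · exact absurd ⟨a, v, c, d, p, q, hB v a ((t.hb a).2 (by simp)) hv, t⟩ hC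
    · exact rootK h hv t

theorem full [Finite V] {G : SimpleGraph V} (hN : ∀ v, ∃ p q r, Nbr G v p q r)
    (hc : IsClawFree G) : ∃ D m, St G Set.univ D m none := by
  have hfin : {S : Set V | ∃ D m, St G S D m none}.Finite := Set.toFinite _
  have hne : {S : Set V | ∃ D m, St G S D m none}.Nonempty := by
    refine ⟨∅, fun _ => none, id, ?_⟩
    constructor <;> simp [Pk]
  obtain ⟨S, hS⟩ := hfin.exists_maximal hne
  obtain ⟨D, m, h⟩ := hS.1
  by_cases hu : ∃ v, v ∉ S
  · obtain ⟨S', D', m', h1, h2⟩ := step hN hc h hu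
    exact absurd (hS.2 ⟨D', m', h1⟩ h2.1) h2.2
  · have : S = Set.univ := by
      ext v
      simpa using not_exists.1 hu v
    subst this
    exact ⟨D, m, h⟩

/-- Two fixed-point-free involutions have a common two-colouring. -/
theorem two_inv {W : Type*} (s t : Equiv.Perm W) (hs : ∀ w, s (s w) = w)
    (ht : ∀ w, t (t w) = w) (hs' : ∀ w, s w ≠ w) (ht' : ∀ w, t w ≠ w) :
    ∃ c : W → Bool, (∀ w, c (s w) ≠ c w) ∧ ∀ w, c (t w) ≠ c w := by
  classical
  have hss : s * s = 1 := Equiv.ext hs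
  have htt : t * t = 1 := Equiv.ext ht
  have hsi : s⁻¹ = s := inv_eq_of_mul_eq_one_left hss
  have hti : t⁻¹ = t := inv_eq_of_mul_eq_one_left htt
  set ρ := s * t with hρ
  have hconj : ∀ k : ℤ, s * ρ ^ k = ρ ^ (-k) * s := by
    intro k
    have h1 : s * ρ * s⁻¹ = ρ⁻¹ := by
      rw [hρ, mul_inv_rev, hsi, hti, ← mul_assoc, hss, one_mul]
    have h2 : s * ρ ^ k * s⁻¹ = ρ ^ (-k) := by
      rw [← conj_zpow, h1, inv_zpow, zpow_neg]
    rw [← h2]; simp [mul_assoc]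
  let st : Setoid W := Equiv.Perm.SameCycle.setoid ρ
  have hmap : ∀ a b, ρ.SameCycle a b → ρ.SameCycle (s a) (s b) := by
    rintro a b ⟨k, rfl⟩
    refine ⟨-k, ?_⟩
    rw [← Equiv.Perm.mul_apply, ← hconj, Equiv.Perm.mul_apply]
  have hnot : ∀ a, ¬ ρ.SameCycle a (s a) := by
    rintro a ⟨k, hk⟩
    rcases Int.even_or_odd' k with ⟨j, rfl | rfl⟩
    · apply hs' ((ρ ^ j) a)
      rw [← Equiv.Perm.mul_apply, hconj, Equiv.Perm.mul_apply, ← hk, ← Equiv.Perm.mul_apply,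
        ← zpow_add]
      congr 2; ring
    · apply ht' ((ρ ^ j) a)
      have : t = s * ρ := by rw [hρ, ← mul_assoc, hss, one_mul]
      rw [this, Equiv.Perm.mul_apply, ← Equiv.Perm.mul_apply ρ, ← zpow_one_add,
        ← Equiv.Perm.mul_apply, hconj, Equiv.Perm.mul_apply, ← hk, ← Equiv.Perm.mul_apply,
        ← zpow_add]
      congr 2; ring
  let Q := Quotient st
  let _ : LinearOrder Q := linearOrderOfSTO WellOrderingRel
  let π : W → Q := Quotient.mk st
  have hne : ∀ a, π (s a) ≠ π a := fun a h => hnot a (Quotient.exact h).symm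
  have hst : ∀ a, π (t a) = π (s a) := by
    intro a
    have : t a = s (ρ a) := by rw [hρ, Equiv.Perm.mul_apply, hs]
    rw [this]
    exact Quotient.sound (hmap _ _ ⟨-1, by simp⟩)
  have hst2 : ∀ a, π (s (t a)) = π a := by
    intro a
    exact Quotient.sound (⟨-1, by rw [← Equiv.Perm.mul_apply s t, ← hρ]; simp⟩ : ρ.SameCycle _ _)
  have hx : ∀ p q : Q, p ≠ q → decide (p < q) ≠ decide (q < p) := by
    intro p q hpq
    rcases lt_or_gt_of_ne hpq with h | h
    · simp [h, h.not_gt]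
    · simp [h, h.not_gt]
  refine ⟨fun a => decide (π a < π (s a)), fun a => ?_, fun a => ?_⟩
  · simp only [hs]
    exact hx _ _ (hne a)
  · simp only [hst2, hst]
    exact hx _ _ (hne a)

/-- Two involutions (with possible fixed points) have a common two-colouring of moved pairs. -/
theorem two_inv' (s t : V → V) (hs : ∀ w, s (s w) = w) (ht : ∀ w, t (t w) = w) :
    ∃ c : V → Bool, (∀ w, s w ≠ w → c (s w) ≠ c w) ∧ ∀ w, t w ≠ w → c (t w) ≠ c w := by
  let f : (V → V) → V × Bool → V × Bool := fun s p =>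
    if s p.1 = p.1 then (p.1, !p.2) else (s p.1, p.2)
  have hf : ∀ s : V → V, (∀ w, s (s w) = w) → Function.Involutive (f s) := by
    rintro s hs ⟨v, b⟩
    have := hs v
    simp only [f]
    by_cases h : s v = v
    · simp [h]
    · have h3 : ¬ v = s v := fun h' => h h'.symm
      simp [h, hs, h3]
  have hf' : ∀ s : V → V, ∀ p, f s p ≠ p := by
    rintro s ⟨v, b⟩
    simp only [f]
    by_cases h : s v = v
    · simp [h]
    · simp [h]
  obtain ⟨c, h1, h2⟩ := two_inv (hf s hs).toPerm (hf t ht).toPerm (hf s hs) (hf t ht) (hf' s)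
    (hf' t)
  refine ⟨fun v => c (v, false), fun v hv => ?_, fun v hv => ?_⟩
  · have := h1 (v, false)
    simpa [f, hv] using this
  · have := h2 (v, false)
    simpa [f, hv] using this

theorem coloring [Finite V] {G : SimpleGraph V} (hN : ∀ v, ∃ p q r, Nbr G v p q r)
    (hc : IsClawFree G) : ∃ (D : V → Option Bool) (c : V → Bool), Pk G D ∧
      ∀ u v, G.Adj u v → D u = none → D v = none → c u ≠ c v := by
  classical
  obtain ⟨D, m, h⟩ := full hN hc
  let P : V → V → Prop := fun v w => G.Adj v w ∧ D v = none ∧ D w = none ∧ w ≠ m v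
  let t : V → V := fun v => if h : ∃ w, P v w then h.choose else v
  have hP : ∀ v w, P v w → P w v := by
    rintro v w ⟨h1, h2, h3, h4⟩
    refine ⟨h1.symm, h3, h2, fun h' => h4 ?_⟩
    rw [h', h.minv]
  have ht1 : ∀ v w, P v w → t v = w := by
    intro v w hw
    have hex : ∃ w, P v w := ⟨w, hw⟩
    have h1 : t v = hex.choose := dif_pos hex
    obtain ⟨a1, a2, a3, a4⟩ := hex.choose_spec
    obtain ⟨b1, b2, b3, b4⟩ := hw
    rw [h1]
    exact h.bip v _ _ trivial a2 (by simp) a1 b1 a3 b3 a4 b4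
  have htt : ∀ v, t (t v) = v := by
    intro v
    by_cases hex : ∃ w, P v w
    · obtain ⟨w, hw⟩ := hex
      rw [ht1 v w hw, ht1 w v (hP v w hw)]
    · have h1 : t v = v := dif_neg hex
      rw [h1, h1]
  obtain ⟨c, c1, c2⟩ := two_inv' m t h.minv htt
  refine ⟨D, c, h.pack, fun u v huv hu hv => ?_⟩
  by_cases hm : v = m u
  · have := c1 u (hm ▸ huv.ne')
    rw [← hm] at this
    exact this.symm
  · have h1 := ht1 u v ⟨huv, hu, hv, hm⟩
    have := c2 u (h1 ▸ huv.ne')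
    rw [h1] at this
    exact this.symm

theorem sub_walk {G : SimpleGraph V} (n : ℕ) : ∀ (u v : V)
    (p : (subdivision G).Walk (Sum.inl u) (Sum.inl v)), p.length ≤ n →
    ∃ q : G.Walk u v, 2 * q.length ≤ p.length := by
  induction n using Nat.strong_induction_on with
  | _ n ih =>
    intro u v p hp
    have hgen : ∀ (y : V ⊕ G.edgeSet), y = Sum.inl v →
        ∀ p : (subdivision G).Walk (Sum.inl u) y, p.length ≤ n →
        ∃ q : G.Walk u v, 2 * q.length ≤ p.length := by
      intro y hy p hp
      cases p with
      | nil =>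
        obtain rfl : u = v := by simpa using hy
        exact ⟨SimpleGraph.Walk.nil, by simp⟩
      | cons h1 p1 =>
        cases p1 with
        | nil =>
          subst hy
          simp [subdivision] at h1
        | @cons _ w _ h2 p2 =>
          rename_i x
          subst hy
          simp only [SimpleGraph.Walk.length_cons] at hp ⊢
          rcases x with x | e
          · simp [subdivision] at h1
          rcases w with w | e'
          · obtain ⟨q, hq⟩ := ih (n - 2) (by omega) w v p2 (by omega)
            have hu : u ∈ (e : Sym2 V) := by simpa [subdivision] using h1
            have hw : w ∈ (e : Sym2 V) := by simpa [subdivision] using h2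
            by_cases huw : u = w
            · subst huw
              exact ⟨q, by omega⟩
            · have he : (e : Sym2 V) = s(u, w) := ((Sym2.mem_and_mem_iff huw).1 ⟨hu, hw⟩)
              have hadj : G.Adj u w := by
                have := e.2
                rw [he] at this
                exact this
              exact ⟨SimpleGraph.Walk.cons hadj q, by simp; omega⟩
          · simp [subdivision] at h2
    exact hgen _ rfl p hp

theorem sub_edist {G : SimpleGraph V} {u v : V} {n : ℕ}
    (h : (subdivision G).edist (Sum.inl u) (Sum.inl v) ≤ n) :
    ∃ q : G.Walk u v, 2 * q.length ≤ n := by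
  have hne : (subdivision G).edist (Sum.inl u) (Sum.inl v) ≠ ⊤ :=
    ne_top_of_le_ne_top (by simp) h
  obtain ⟨p, hp⟩ := SimpleGraph.exists_walk_of_edist_ne_top hne
  obtain ⟨q, hq⟩ := sub_walk p.length u v p le_rfl
  rw [← hp] at h
  have : p.length ≤ n := by exact_mod_cast h
  exact ⟨q, by omega⟩

theorem walk_one {G : SimpleGraph V} {u v : V} (q : G.Walk u v) (h : q.length ≤ 1) :
    u = v ∨ G.Adj u v := by
  cases q with
  | nil => exact Or.inl rfl
  | cons h1 q =>
    cases q with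
    | nil => exact Or.inr h1
    | cons h2 q => simp at h

theorem walk_two {G : SimpleGraph V} {u v : V} (q : G.Walk u v) (h : q.length ≤ 2) :
    u = v ∨ G.Adj u v ∨ ∃ w, G.Adj u w ∧ G.Adj v w := by
  cases q with
  | nil => exact Or.inl rfl
  | cons h1 q =>
    rcases walk_one q (by simpa using h) with rfl | h2
    · exact Or.inr (Or.inl h1)
    · exact Or.inr (Or.inr ⟨_, h1, h2.symm⟩)

end ClawFreeProof

/-- For every claw-free cubic graph `G`, the subdivision `S(G)` has packing chromatic
number at most `5`, i.e. it admits a `(1,2,3,4,5)`-packing coloring. -/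
theorem subdivision_of_clawfree_cubic_packing_chromatic_le_five
    {V : Type*} [Fintype V] [DecidableEq V] (G : SimpleGraph V) [DecidableRel G.Adj]
    (hcubic : ∀ v : V, G.degree v = 3) (hclawfree : IsClawFree G) :
    ∃ g : V ⊕ G.edgeSet → Fin 5, IsColoring12345 (subdivision G) g := by
  classical
  have hN := ClawFreeProof.nbr_exists G hcubic
  obtain ⟨D, c, hD, hc⟩ := ClawFreeProof.coloring hN hclawfree
  let col : V → Fin 5 := fun v => match D v with
    | some true => 3
    | some false => 4
    | none => if c v then 1 else 2
  refine ⟨Sum.elim col (fun _ => 0), ?_⟩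
  have hcol0 : ∀ v, col v ≠ 0 := by
    intro v
    simp only [col]
    rcases D v with _ | _ | _ <;> by_cases h : c v <;> simp [h]
  rintro (u | e) (v | e') huv hcol
  · simp only [Sum.elim_inl] at hcol ⊢
    have huv' : u ≠ v := fun h => huv (by rw [h])
    by_contra hlt
    have hle : (subdivision G).edist (Sum.inl u) (Sum.inl v) ≤ (((col u : ℕ) + 1 : ℕ) : ℕ∞) := by
      push_cast
      exact not_lt.1 hlt
    obtain ⟨q, hq⟩ := ClawFreeProof.sub_edist hle
    have hbad : ∀ b, D u = some b → D v = some b → False := by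
      intro b hu hv
      obtain ⟨h1, h2⟩ := hD u v b huv' hu hv
      have h5 : (col u : ℕ) ≤ 4 := by omega
      rcases ClawFreeProof.walk_two q (by omega) with h | h | ⟨w, h, h'⟩
      · exact huv' h
      · exact h1 h
      · exact h2 w h h'
    have hbad2 : D u = none → D v = none → c u = c v → False := by
      intro hu hv hcc
      have h5 : (col u : ℕ) ≤ 2 := by
        simp only [col, hu]
        by_cases h : c u <;> simp [h]
      rcases ClawFreeProof.walk_one q (by omega) with h | h
      · exact huv' h
      · exact hc u v h hu hv hcc
    simp only [col] at hcol
    rcases hu : D u with _ | _ | _ <;> rcases hv : D v with _ | _ | _ <;>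
      simp only [hu, hv] at hcol <;>
      by_cases h1 : c u <;> by_cases h2 : c v <;> (try simp [h1, h2] at hcol) <;>
      first
      | exact hbad _ hu hv
      | exact hbad2 hu hv (by simp [h1, h2])
  · exact absurd hcol (hcol0 u)
  · exact absurd hcol.symm (hcol0 v)
  · simp only [Sum.elim_inr]
    have hna : ¬ (subdivision G).Adj (Sum.inr e) (Sum.inr e') := by simp [subdivision]
    by_contra hlt
    have hle : (subdivision G).edist (Sum.inr e) (Sum.inr e') ≤ 1 := by
      simpa using hlt
    exact hna (SimpleGraph.edist_le_one_iff_adj_or_eq.1 hle |>.resolve_right huv)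
end
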